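/- Let G be a finite connected subcubic simple graph on n vertices and m edges such that G does not contain two vertex-disjoint cycles each of length less than five, and G contains no induced subdivision of any member of the family 𝓕. Then φ(G) ≤ (2m − n + 6)/7. -/

import Mathlib

open SimpleGraph

/-- The minimum size of a feedback vertex set of `G`. -/
noncomputable def phi {V : Type} (G : SimpleGraph V) : ℕ :=
  sInf {n : ℕ | ∃ S : Finset V, S.card = n ∧ (G.induce ((S : Set V)ᶜ)).IsAcyclic}

/-- The graph obtained from `H` by subdividing the edge `uv` once: delete the edge `uv`
and add a new vertex (`none`) adjacent exactly to `u` and `v`. -/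
def subdivideEdge {V : Type} (H : SimpleGraph V) (u v : V) : SimpleGraph (Option V) :=
  SimpleGraph.fromRel (fun x y =>
    (∃ p q : V, x = some p ∧ y = some q ∧ H.Adj p q ∧ s(p, q) ≠ s(u, v)) ∨
    (x = none ∧ (y = some u ∨ y = some v)))

/-- `a` has degree exactly two in `H`. -/
def HasDegreeTwo {V : Type} (H : SimpleGraph V) (a : V) : Prop :=
  ∃ x y : V, x ≠ y ∧ H.Adj a x ∧ H.Adj a y ∧ ∀ z : V, H.Adj a z → z = x ∨ z = y

/-- The operation `∘` applied with two distinct edges `u₁v₁`, `u₂v₂` and a degree-two vertex `a`: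
subdivide both edges (new vertices `inr 0`, `inr 1`), then add a new vertex `inr 2` adjacent to
`a` and the two subdivision vertices. -/
def circOpTwo {V : Type} (H : SimpleGraph V) (u₁ v₁ u₂ v₂ a : V) : SimpleGraph (V ⊕ Fin 3) :=
  SimpleGraph.fromRel (fun x y =>
    (∃ p q : V, x = Sum.inl p ∧ y = Sum.inl q ∧ H.Adj p q ∧
      s(p, q) ≠ s(u₁, v₁) ∧ s(p, q) ≠ s(u₂, v₂)) ∨
    (x = Sum.inr 0 ∧ (y = Sum.inl u₁ ∨ y = Sum.inl v₁)) ∨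
    (x = Sum.inr 1 ∧ (y = Sum.inl u₂ ∨ y = Sum.inl v₂)) ∨
    (x = Sum.inr 2 ∧ (y = Sum.inl a ∨ y = Sum.inr 0 ∨ y = Sum.inr 1)))

/-- The operation `∘` applied with `e₁ = e₂ = uv` and a degree-two vertex `a`: subdivide the
edge `uv` twice (replacing it by the path `u, inr 0, inr 1, v`), then add a new vertex `inr 2`
adjacent to `a` and the two subdivision vertices. -/
def circOpOne {V : Type} (H : SimpleGraph V) (u v a : V) : SimpleGraph (V ⊕ Fin 3) :=
  SimpleGraph.fromRel (fun x y =>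
    (∃ p q : V, x = Sum.inl p ∧ y = Sum.inl q ∧ H.Adj p q ∧ s(p, q) ≠ s(u, v)) ∨
    (x = Sum.inr 0 ∧ (y = Sum.inl u ∨ y = Sum.inr 1)) ∨
    (x = Sum.inr 1 ∧ y = Sum.inl v) ∨
    (x = Sum.inr 2 ∧ (y = Sum.inl a ∨ y = Sum.inr 0 ∨ y = Sum.inr 1)))

/-- `G` is obtained from `H` by one application of the operation `∘` at the degree-two
vertex `a`, using two (not necessarily distinct) edges of `H`. -/
def IsCircOp {V : Type} (H : SimpleGraph V) (a : V) (G : SimpleGraph (V ⊕ Fin 3)) : Prop :=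
  (∃ u₁ v₁ u₂ v₂ : V, H.Adj u₁ v₁ ∧ H.Adj u₂ v₂ ∧ s(u₁, v₁) ≠ s(u₂, v₂) ∧
      G = circOpTwo H u₁ v₁ u₂ v₂ a) ∨
  (∃ u v : V, H.Adj u v ∧ G = circOpOne H u v a)

/-- Membership (up to isomorphism) in the family `F_{i,j}`. -/
inductive IsInF : ∀ (i j : ℕ) {V : Type}, SimpleGraph V → Prop
  | cycle (i : ℕ) (hi : 3 ≤ i) : IsInF i 0 (SimpleGraph.cycleGraph i)
  | k4 : IsInF 1 1 (⊤ : SimpleGraph (Fin 4))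
  | subdiv {i j : ℕ} {V : Type} {H : SimpleGraph V} {u v : V}
      (huv : H.Adj u v) (hH : IsInF i j H) : IsInF (i + 1) j (subdivideEdge H u v)
  | op {i j : ℕ} {V : Type} {H : SimpleGraph V} {a : V} {G : SimpleGraph (V ⊕ Fin 3)}
      (ha : HasDegreeTwo H a) (hG : IsCircOp H a G) (hH : IsInF i j H) : IsInF i (j + 1) G
  | iso {i j : ℕ} {V W : Type} {H : SimpleGraph V} {G : SimpleGraph W}
      (e : Nonempty (G ≃g H)) (hH : IsInF i j H) : IsInF i j G

/-- `G` is a graph obtained from `H` by repeatedly (possibly zero times) subdividing edges. -/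
inductive IsSubdivisionOf : ∀ {V : Type}, SimpleGraph V → ∀ {W : Type}, SimpleGraph W → Prop
  | refl {V : Type} (G : SimpleGraph V) : IsSubdivisionOf G G
  | step {V W : Type} {H : SimpleGraph V} {G : SimpleGraph W} {u v : W}
      (huv : G.Adj u v) (h : IsSubdivisionOf H G) : IsSubdivisionOf H (subdivideEdge G u v)

/-- `G` contains an induced subdivision of `H`: some induced subgraph of `G` is isomorphic
to a graph obtained from `H` by repeatedly subdividing edges. -/
def ContainsInducedSubdivision {V W : Type} (G : SimpleGraph V) (H : SimpleGraph W) : Prop :=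
  ∃ (s : Set V) (U : Type) (K : SimpleGraph U),
    IsSubdivisionOf H K ∧ Nonempty (G.induce s ≃g K)

/-- The family `𝓕`: members of `F_{4,2} ∪ F_{4,3}` of girth at least five, together with
members `H` of `F_{3,2} ∪ F_{3,3}` having an edge `e` such that `H − e` has girth at least
five. -/
def InFamilyF {W : Type} (H : SimpleGraph W) : Prop :=
  ((IsInF 4 2 H ∨ IsInF 4 3 H) ∧ 5 ≤ H.girth) ∨
  ((IsInF 3 2 H ∨ IsInF 3 3 H) ∧ ∃ e ∈ H.edgeSet, 5 ≤ (H.deleteEdges {e}).girth)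

/-- `G` contains two vertex-disjoint cycles, each of length less than five. -/
def HasTwoDisjointShortCycles {V : Type} (G : SimpleGraph V) : Prop :=
  ∃ (u v : V) (c₁ : G.Walk u u) (c₂ : G.Walk v v), c₁.IsCycle ∧ c₂.IsCycle ∧
    c₁.length < 5 ∧ c₂.length < 5 ∧ ∀ x : V, x ∈ c₁.support → x ∉ c₂.support

set_option linter.unusedVariables false
set_option linter.unusedSectionVars false

section Counting
open scoped Classical
open Finset

variable {V : Type} [Fintype V]

/-- edges of `G` inside `X` -/
noncomputable def ed (G : SimpleGraph V) (X : Finset V) : Finset (Sym2 V) :=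
  univ.filter (fun e => e ∈ G.edgeSet ∧ ∀ x ∈ e, x ∈ X)

/-- degree of `x` into `X` -/
noncomputable def dg (G : SimpleGraph V) (X : Finset V) (x : V) : ℕ :=
  (X.filter (fun y => G.Adj x y)).card

lemma mem_ed {G : SimpleGraph V} {X : Finset V} {a b : V} :
    s(a, b) ∈ ed G X ↔ G.Adj a b ∧ a ∈ X ∧ b ∈ X := by
  simp [ed]

lemma ed_insert (G : SimpleGraph V) (X : Finset V) (v : V) (hv : v ∉ X) :
    (ed G (insert v X)).card = (ed G X).card + dg G X v := by
  have h : ed G (insert v X) = ed G X ∪ (X.filter (fun y => G.Adj v y)).image (fun y => s(v, y)) := by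
    ext e
    induction e using Sym2.ind with
    | _ a b =>
      simp only [mem_union, mem_ed, mem_image, mem_filter, mem_insert]
      constructor
      · rintro ⟨h, ha, hb⟩
        rcases ha with rfl | ha
        · rcases hb with rfl | hb
          · exact absurd h (G.loopless.irrefl _)
          · exact Or.inr ⟨b, ⟨hb, h⟩, rfl⟩
        · rcases hb with rfl | hb
          · exact Or.inr ⟨a, ⟨ha, h.symm⟩, Sym2.eq_swap⟩
          · exact Or.inl ⟨h, ha, hb⟩
      · rintro (⟨h, ha, hb⟩ | ⟨y, ⟨hy, h⟩, he⟩)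
        · exact ⟨h, Or.inr ha, Or.inr hb⟩
        · rcases Sym2.eq_iff.1 he with ⟨rfl, rfl⟩ | ⟨rfl, rfl⟩
          · exact ⟨h, Or.inl rfl, Or.inr hy⟩
          · exact ⟨h.symm, Or.inr hy, Or.inl rfl⟩
  rw [h, card_union_of_disjoint, card_image_of_injOn]
  · rfl
  · intro a _ b _ hab
    rcases Sym2.eq_iff.1 hab with h | h
    · exact h.2
    · exact h.2.trans h.1
  · rw [Finset.disjoint_left]
    intro e he he'
    obtain ⟨y, hy, rfl⟩ := mem_image.1 he'
    exact hv (mem_ed.1 he).2.1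

lemma ed_erase (G : SimpleGraph V) (X : Finset V) (v : V) (hv : v ∈ X) :
    (ed G X).card = (ed G (X.erase v)).card + dg G X v := by
  have h := ed_insert G (X.erase v) v (by simp)
  rw [insert_erase hv] at h
  rw [h]
  suffices h' : (X.erase v).filter (fun y => G.Adj v y) = X.filter (fun y => G.Adj v y) by
    unfold dg; rw [h']
  ext y
  simp only [mem_filter, mem_erase]
  constructor
  · rintro ⟨⟨_, h1⟩, h2⟩; exact ⟨h1, h2⟩
  · rintro ⟨h1, h2⟩; exact ⟨⟨h2.ne', h1⟩, h2⟩

lemma ed_empty (G : SimpleGraph V) : (ed G ∅).card = 0 := by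
  rw [card_eq_zero]
  ext e
  induction e using Sym2.ind with
  | _ a b => simp [mem_ed]

lemma ed_singleton (G : SimpleGraph V) (v : V) : (ed G {v}).card = 0 := by
  rw [card_eq_zero]
  ext e
  induction e using Sym2.ind with
  | _ a b =>
    simp only [mem_ed, mem_singleton, notMem_empty, iff_false]
    rintro ⟨h, rfl, rfl⟩
    exact G.loopless.irrefl _ h

lemma sum_dg (G : SimpleGraph V) (X : Finset V) : ∑ x ∈ X, dg G X x = 2 * (ed G X).card := by
  induction X using Finset.induction_on with
  | empty => simp [ed_empty]
  | insert v X hv ih =>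
    rw [ed_insert G X v hv, sum_insert hv]
    have h1 : dg G (insert v X) v = dg G X v := by
      unfold dg; congr 1; rw [filter_insert]; simp
    have h2 : ∀ x ∈ X, dg G (insert v X) x = dg G X x + if G.Adj v x then 1 else 0 := by
      intro x hx
      unfold dg; rw [filter_insert]
      by_cases h : G.Adj v x
      · rw [if_pos h.symm, if_pos h, card_insert_of_notMem]
        simp [hv]
      · rw [if_neg (fun h' => h h'.symm), if_neg h, add_zero]
    rw [h1, sum_congr rfl h2, sum_add_distrib, ih]
    have h3 : ∑ x ∈ X, (if G.Adj v x then 1 else 0) = dg G X v := by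
      unfold dg; rw [card_filter]
    rw [h3]; ring

/-- `X` induces a forest (counting form) -/
def Forest (G : SimpleGraph V) (X : Finset V) : Prop :=
  ∀ Y ⊆ X, Y.Nonempty → (ed G Y).card < Y.card

lemma cycle_count {G : SimpleGraph V} {u : V} (c : G.Walk u u) (hc : c.IsCycle) :
    c.support.toFinset.card ≤ (ed G c.support.toFinset).card := by
  have h1 : c.support.toFinset.card ≤ c.length := by
    have : c.support.toFinset = c.support.tail.toFinset := by
      ext x
      simp only [List.mem_toFinset]
      constructor
      · intro hx
        rw [SimpleGraph.Walk.mem_support_iff] at hx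
        rcases hx with rfl | hx
        · exact SimpleGraph.Walk.end_mem_tail_support hc.not_nil
        · exact hx
      · exact List.mem_of_mem_tail
    rw [this]
    refine (List.toFinset_card_le _).trans ?_
    simp
  have h2 : c.edges.toFinset.card = c.length := by
    rw [List.toFinset_card_of_nodup hc.edges_nodup]; simp
  rw [← h2] at h1
  refine h1.trans (card_le_card ?_)
  intro e he
  induction e using Sym2.ind with
  | _ a b =>
    have he' := List.mem_toFinset.1 he
    rw [mem_ed]
    exact ⟨c.adj_of_mem_edges he', List.mem_toFinset.2 (c.fst_mem_support_of_mem_edges he'),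
      List.mem_toFinset.2 (c.snd_mem_support_of_mem_edges he')⟩

lemma map_induce_support {G : SimpleGraph V} {s : Set V} {u v : s} (c : (G.induce s).Walk u v) :
    ∀ x ∈ (c.map (SimpleGraph.Embedding.induce s).toHom).support, x ∈ s := by
  intro x hx
  rw [SimpleGraph.Walk.support_map, List.mem_map] at hx
  obtain ⟨y, _, rfl⟩ := hx
  exact y.2

lemma phi_le_of_forest (G : SimpleGraph V) (S : Finset V) (h : Forest G Sᶜ) : phi G ≤ S.card := by
  apply Nat.sInf_le
  refine ⟨S, rfl, ?_⟩
  intro u c hc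
  have hc' := (SimpleGraph.Walk.isCycle_map_iff_of_injective
    (f := (SimpleGraph.Embedding.induce ((S : Set V)ᶜ) : G.induce ((S : Set V)ᶜ) ↪g G).toHom)
    (SimpleGraph.Embedding.induce ((S : Set V)ᶜ) : G.induce ((S : Set V)ᶜ) ↪g G).injective).2 hc
  have h1 := cycle_count _ hc'
  refine absurd h1 (not_le.2 (h _ ?_ ?_))
  · intro x hx
    have := map_induce_support c x (List.mem_toFinset.1 hx)
    simpa using this
  · exact ⟨_, List.mem_toFinset.2 (SimpleGraph.Walk.start_mem_support _)⟩

/-- weight of a part -/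
noncomputable def bet (G : SimpleGraph V) (X : Finset V) : ℤ := (ed G X).card - X.card + 1
noncomputable def wt (G : SimpleGraph V) (X : Finset V) : ℤ := bet G X + bet G X % 2

lemma wt_even (G : SimpleGraph V) (X : Finset V) : wt G X % 2 = 0 := by unfold wt; omega

lemma wt_singleton (G : SimpleGraph V) (v : V) : wt G {v} = 0 := by
  simp [wt, bet, ed_singleton]

/-- partitions of a finite set -/
def IsPart (Q : Finset (Finset V)) (P : Finset V) : Prop :=
  ∅ ∉ Q ∧ (∀ A ∈ Q, ∀ B ∈ Q, A ≠ B → Disjoint A B) ∧ Q.biUnion id = P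

lemma isPart_singleton {P : Finset V} (h : P.Nonempty) : IsPart {P} P := by
  refine ⟨?_, ?_, by simp⟩
  · simpa [eq_comm] using h.ne_empty
  · intro A hA B hB; simp at hA hB; subst hA; subst hB; simp

lemma IsPart.subset {Q : Finset (Finset V)} {P : Finset V} (h : IsPart Q P) {A} (hA : A ∈ Q) :
    A ⊆ P := by
  rw [← h.2.2]; exact subset_biUnion_of_mem id hA

lemma IsPart.nonempty {Q : Finset (Finset V)} {P : Finset V} (h : IsPart Q P) {A} (hA : A ∈ Q) :
    A.Nonempty := by
  rw [nonempty_iff_ne_empty]; rintro rfl; exact h.1 hA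

lemma IsPart.sub {Q I : Finset (Finset V)} {P : Finset V} (h : IsPart Q P) (hI : I ⊆ Q) :
    IsPart I (I.biUnion id) :=
  ⟨fun h0 => h.1 (hI h0), fun A hA B hB => h.2.1 A (hI hA) B (hI hB), rfl⟩

lemma IsPart.union {Q R : Finset (Finset V)} {P P' : Finset V} (h : IsPart Q P) (h' : IsPart R P')
    (hd : Disjoint P P') : IsPart (Q ∪ R) (P ∪ P') ∧ Disjoint Q R := by
  have key : ∀ A ∈ Q, ∀ B ∈ R, Disjoint A B := fun A hA B hB =>
    Disjoint.mono (h.subset hA) (h'.subset hB) hd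
  refine ⟨⟨?_, ?_, ?_⟩, ?_⟩
  · simp [h.1, h'.1]
  · intro A hA B hB hne
    rcases mem_union.1 hA with hA | hA <;> rcases mem_union.1 hB with hB | hB
    · exact h.2.1 A hA B hB hne
    · exact key A hA B hB
    · exact (key B hB A hA).symm
    · exact h'.2.1 A hA B hB hne
  · rw [union_biUnion, h.2.2, h'.2.2]
  · rw [Finset.disjoint_left]
    intro A hA hA'
    have := key A hA A hA'
    rw [disjoint_self] at this
    exact h.1 (by rw [← bot_eq_empty, ← this]; exact hA)

lemma IsPart.disj_of {Q I : Finset (Finset V)} {P : Finset V} (h : IsPart Q P) (hI : I ⊆ Q) :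
    Disjoint ((Q \ I).biUnion id) (I.biUnion id) := by
  rw [disjoint_biUnion_left]; intro A hA
  rw [disjoint_biUnion_right]; intro B hB
  rw [mem_sdiff] at hA
  exact h.2.1 A hA.1 B (hI hB) (by rintro rfl; exact hA.2 hB)

lemma IsPart.replace {Q I R : Finset (Finset V)} {P : Finset V} (h : IsPart Q P) (hI : I ⊆ Q)
    (hR : IsPart R (I.biUnion id)) : IsPart ((Q \ I) ∪ R) P ∧ Disjoint (Q \ I) R := by
  have := (h.sub (I := Q \ I) sdiff_subset).union hR (h.disj_of hI)
  rwa [← union_biUnion, sdiff_union_of_subset hI, h.2.2] at this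

lemma IsPart.card_le {Q : Finset (Finset V)} {P : Finset V} (h : IsPart Q P) :
    Q.card ≤ Fintype.card V := by
  have h1 : P.card = ∑ A ∈ Q, A.card := by
    rw [← h.2.2, card_biUnion]; rfl
    intro A hA B hB hne; exact h.2.1 A hA B hB hne
  have h2 : ∑ A ∈ Q, 1 ≤ ∑ A ∈ Q, A.card := sum_le_sum fun A hA => (h.nonempty hA).card_pos
  have h3 := card_le_univ P
  simp at h2; omega

/-- perturbed total weight -/
noncomputable def Wt (G : SimpleGraph V) (Q : Finset (Finset V)) : ℤ :=
  ∑ A ∈ Q, ((Fintype.card V + 1 : ℤ) * wt G A + 1)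

lemma Wt_eq (G : SimpleGraph V) (Q : Finset (Finset V)) :
    Wt G Q = (Fintype.card V + 1 : ℤ) * (∑ A ∈ Q, wt G A) + Q.card := by
  simp [Wt, sum_add_distrib, mul_sum]

def IsOpt (G : SimpleGraph V) (Q : Finset (Finset V)) (P : Finset V) : Prop :=
  IsPart Q P ∧ ∀ R, IsPart R P → Wt G R ≤ Wt G Q

lemma exists_opt (G : SimpleGraph V) (P : Finset V) : ∃ Q, IsOpt G Q P := by
  have hne : (univ.filter (fun Q : Finset (Finset V) => IsPart Q P)).Nonempty := by
    rcases P.eq_empty_or_nonempty with rfl | h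
    · exact ⟨∅, mem_filter.2 ⟨mem_univ _, by simp [IsPart]⟩⟩
    · exact ⟨{P}, by simpa using isPart_singleton h⟩
  obtain ⟨Q, hQ, hmax⟩ := exists_max_image _ (Wt G) hne
  exact ⟨Q, (mem_filter.1 hQ).2, fun R hR => hmax R (by simpa using hR)⟩

lemma IsOpt.replace {G : SimpleGraph V} {Q I R : Finset (Finset V)} {P : Finset V}
    (h : IsOpt G Q P) (hI : I ⊆ Q) (hR : IsPart R (I.biUnion id)) : Wt G R ≤ Wt G I := by
  obtain ⟨h1, h2⟩ := h.1.replace hI hR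
  have h3 := h.2 _ h1
  unfold Wt at *
  rw [sum_union h2] at h3
  have h4 := sum_sdiff (f := fun A => ((Fintype.card V + 1 : ℤ) * wt G A + 1)) hI
  linarith

lemma IsOpt.replace1 {G : SimpleGraph V} {Q R : Finset (Finset V)} {P A : Finset V}
    (h : IsOpt G Q P) (hA : A ∈ Q) (hR : IsPart R A) : Wt G R ≤ Wt G {A} :=
  h.replace (I := {A}) (by simpa using hA) (by simpa using hR)

lemma sum_le_of_Wt {G : SimpleGraph V} {R : Finset (Finset V)} {A : Finset V}
    (hR : IsPart R A) (hP : A.Nonempty) (hw : Wt G R ≤ Wt G {A}) :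
    ∑ B ∈ R, wt G B ≤ wt G A := by
  rw [Wt_eq, Wt_eq] at hw
  simp only [sum_singleton, card_singleton] at hw
  have : R.Nonempty := by
    rw [nonempty_iff_ne_empty]; rintro rfl
    have := hR.2.2; simp at this; subst this; simp at hP
  have h1 := this.card_pos
  have h2 : (1 : ℤ) ≤ R.card := by exact_mod_cast h1
  have h3 : (Fintype.card V + 1 : ℤ) * (∑ A ∈ R, wt G A) ≤ (Fintype.card V + 1 : ℤ) * wt G A := by
    push_cast at hw; linarith
  exact le_of_mul_le_mul_left h3 (by positivity)

lemma sum_lt_of_Wt {G : SimpleGraph V} {R : Finset (Finset V)} {A : Finset V}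
    (hR : 2 ≤ R.card) (hw : Wt G R ≤ Wt G {A}) :
    ∑ B ∈ R, wt G B + 2 ≤ wt G A := by
  rw [Wt_eq, Wt_eq] at hw
  simp only [sum_singleton, card_singleton] at hw
  have h2 : (2 : ℤ) ≤ R.card := by exact_mod_cast hR
  have h3 : (Fintype.card V + 1 : ℤ) * (∑ A ∈ R, wt G A) < (Fintype.card V + 1 : ℤ) * wt G A := by
    push_cast at hw; linarith
  have h4 := lt_of_mul_lt_mul_left h3 (by positivity)
  have h5 : (∑ B ∈ R, wt G B) % 2 = 0 := by
    rw [← Int.dvd_iff_emod_eq_zero]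
    exact dvd_sum fun B _ => Int.dvd_of_emod_eq_zero (wt_even G B)
  have h6 := wt_even G A
  omega
end Counting

section Kill
open scoped Classical
open Finset

variable {V : Type} [Fintype V] {ι : Type} [DecidableEq ι]

noncomputable def cr (G : SimpleGraph V) (l : V → ι) (Y : Finset V) (I : Finset ι) :
    Finset (Sym2 V) :=
  (ed G Y).filter (fun e => (∀ x ∈ e, l x ∈ I) ∧ ∃ x ∈ e, ∃ y ∈ e, l x ≠ l y)

lemma mem_cr {G : SimpleGraph V} {l : V → ι} {Y : Finset V} {I : Finset ι} {a b : V} :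
    s(a, b) ∈ cr G l Y I ↔ (G.Adj a b ∧ a ∈ Y ∧ b ∈ Y) ∧ (l a ∈ I ∧ l b ∈ I) ∧ l a ≠ l b := by
  unfold cr
  rw [mem_filter, mem_ed]
  constructor
  · rintro ⟨h, h1, x, hx, y, hy, hne⟩
    refine ⟨h, ⟨h1 a (by simp), h1 b (by simp)⟩, ?_⟩
    rw [Sym2.mem_iff] at hx hy
    rcases hx with rfl | rfl <;> rcases hy with rfl | rfl
    · exact absurd rfl hne
    · exact hne
    · exact hne.symm
    · exact absurd rfl hne
  · rintro ⟨h, ⟨h1, h2⟩, hne⟩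
    refine ⟨h, ?_, a, by simp, b, by simp, hne⟩
    intro x hx
    rw [Sym2.mem_iff] at hx
    rcases hx with rfl | rfl <;> assumption

lemma ed_split (G : SimpleGraph V) (l : V → ι) (Y : Finset V) (I : Finset ι)
    (h : ∀ y ∈ Y, l y ∈ I) :
    (ed G Y).card = ∑ k ∈ I, (ed G (Y.filter (fun y => l y = k))).card + (cr G l Y I).card := by
  rw [← card_biUnion, ← card_union_of_disjoint]
  · congr 1
    ext e
    induction e using Sym2.ind with
    | _ a b =>
      rw [mem_union, mem_biUnion, mem_cr, mem_ed]
      simp only [mem_ed, mem_filter]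
      constructor
      · rintro ⟨h1, h2, h3⟩
        by_cases h4 : l a = l b
        · exact Or.inl ⟨l b, h b h3, h1, ⟨h2, h4⟩, h3, rfl⟩
        · exact Or.inr ⟨⟨h1, h2, h3⟩, ⟨h a h2, h b h3⟩, h4⟩
      · rintro (⟨k, hk, h1, h2, h3⟩ | h1)
        · exact ⟨h1, h2.1, h3.1⟩
        · exact h1.1
  · rw [Finset.disjoint_left]
    intro e
    induction e using Sym2.ind with
    | _ a b =>
      rw [mem_biUnion, mem_cr]
      simp only [mem_ed, mem_filter]
      rintro ⟨k, hk, h1, h2, h3⟩ h4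
      exact h4.2.2 (h2.2.trans h3.2.symm)
  · intro k hk k' hk' hne
    rw [Function.onFun, Finset.disjoint_left]
    intro e
    induction e using Sym2.ind with
    | _ a b =>
      simp only [mem_ed, mem_filter]
      rintro ⟨h1, h2, h3⟩ ⟨_, h4, _⟩
      exact hne (h2.2.symm.trans h4.2)

lemma cr_super (G : SimpleGraph V) (l : V → ι) (Y : Finset V) (I J : Finset ι) :
    (cr G l Y I).card + (cr G l Y J).card ≤ (cr G l Y (I ∪ J)).card + (cr G l Y (I ∩ J)).card := by
  rw [← card_union_add_card_inter]
  refine Nat.add_le_add (card_le_card ?_) (card_le_card ?_)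
  · intro e
    induction e using Sym2.ind with
    | _ a b => simp only [mem_union, mem_cr]; tauto
  · intro e
    induction e using Sym2.ind with
    | _ a b => simp only [mem_inter, mem_cr]; tauto

lemma cr_mono (G : SimpleGraph V) (l : V → ι) {Y Y' : Finset V} (h : Y ⊆ Y') (I : Finset ι) :
    cr G l Y I ⊆ cr G l Y' I := by
  intro e
  induction e using Sym2.ind with
  | _ a b =>
    simp only [mem_cr]
    rintro ⟨⟨h1, h2, h3⟩, h4⟩
    exact ⟨⟨h1, h h2, h h3⟩, h4⟩

lemma kill (G : SimpleGraph V) (l : V → ι) (N : Finset ι) (B : Finset ι) : B ⊆ N → ∀ Y : Finset V,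
    (∀ I ⊆ N, I.Nonempty → (cr G l Y I).card + 1 ≤ I.card + (I ∩ B).card) →
    ∃ Z ⊆ Y, (∀ z ∈ Z, l z ∈ B) ∧ (∀ z ∈ Z, ∀ z' ∈ Z, l z = l z' → z = z') ∧
      ∀ I ⊆ N, I.Nonempty → (cr G l (Y \ Z) I).card + 1 ≤ I.card := by
  induction B using Finset.induction_on with
  | empty =>
    intro _ Y h
    exact ⟨∅, by simp, by simp, by simp, by simpa using h⟩
  | insert u B hu ih =>
    intro hB Y h
    have huN : u ∈ N := hB (mem_insert_self _ _)
    have hBN : B ⊆ N := fun x hx => hB (mem_insert_of_mem hx)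
    have hin : ∀ I : Finset ι, u ∈ I → (I ∩ insert u B).card = (I ∩ B).card + 1 := by
      intro I hI
      rw [inter_insert_of_mem hI, card_insert_of_notMem]
      simp [hu]
    have hout : ∀ I : Finset ι, u ∉ I → (I ∩ insert u B) = (I ∩ B) := by
      intro I hI
      rw [inter_insert_of_notMem hI]
    let T := N.powerset.filter
      (fun I => u ∈ I ∧ (cr G l Y I).card + 1 = I.card + (I ∩ insert u B).card)
    rcases T.eq_empty_or_nonempty with hT | hT
    · obtain ⟨Z, hZ, h1, h2, h3⟩ := ih hBN Y (by
        intro I hI hne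
        by_cases huI : u ∈ I
        · have h5 := h I hI hne
          have h6 : ¬ ((cr G l Y I).card + 1 = I.card + (I ∩ insert u B).card) := by
            intro h7
            have : I ∈ T := mem_filter.2 ⟨mem_powerset.2 hI, huI, h7⟩
            rw [hT] at this; simp at this
          rw [hin I huI] at h5 h6
          omega
        · have h5 := h I hI hne
          rwa [hout I huI] at h5)
      exact ⟨Z, hZ, fun z hz => mem_insert_of_mem (h1 z hz), h2, h3⟩
    · obtain ⟨I0, hI0, hmin⟩ := exists_min_image T card hT
      obtain ⟨hI0N, huI0, ht0⟩ := mem_filter.1 hI0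
      rw [mem_powerset] at hI0N
      have hsub : ∀ I ∈ T, I0 ⊆ I := by
        intro I hI
        obtain ⟨hIN, huI, ht⟩ := mem_filter.1 hI
        rw [mem_powerset] at hIN
        have hcap : I0 ∩ I ∈ T := by
          refine mem_filter.2 ⟨mem_powerset.2 (inter_subset_left.trans hI0N), mem_inter.2 ⟨huI0, huI⟩, ?_⟩
          have h1 := cr_super G l Y I0 I
          have h2 := h (I0 ∪ I) (union_subset hI0N hIN) ⟨u, mem_union_left _ huI0⟩
          have h3 := h (I0 ∩ I) (inter_subset_left.trans hI0N) ⟨u, mem_inter.2 ⟨huI0, huI⟩⟩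
          have h4 := card_union_add_card_inter I0 I
          have h5 := card_union_add_card_inter (I0 ∩ insert u B) (I ∩ insert u B)
          rw [← union_inter_distrib_right, ← inter_inter_distrib_right] at h5
          omega
        have h1 := hmin _ hcap
        have h2 := eq_of_subset_of_card_le (inter_subset_left : I0 ∩ I ⊆ I0) h1
        exact inter_eq_left.1 h2
      have hedge : ∃ x y, G.Adj x y ∧ x ∈ Y ∧ y ∈ Y ∧ l x = u ∧ l y ∈ I0 ∧ l y ≠ u := by
        by_contra hno
        push Not at hno
        have hs : cr G l Y I0 ⊆ cr G l Y (I0.erase u) := by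
          intro e
          induction e using Sym2.ind with
          | _ a b =>
            simp only [mem_cr, mem_erase]
            rintro ⟨⟨h1, h2, h3⟩, ⟨h4, h5⟩, h6⟩
            refine ⟨⟨h1, h2, h3⟩, ⟨⟨?_, h4⟩, ⟨?_, h5⟩⟩, h6⟩
            · intro ha
              have := hno a b h1 h2 h3 ha h5
              exact h6 (ha.trans this.symm)
            · intro hb
              have := hno b a h1.symm h3 h2 hb h4
              exact h6 (this.trans hb.symm)
        have hs' := card_le_card hs
        have hc := card_erase_add_one huI0
        rw [hin I0 huI0] at ht0
        rcases (I0.erase u).eq_empty_or_nonempty with he | he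
        · rw [he] at hs' hc
          have : cr G l Y ∅ = ∅ := by
            ext e
            induction e using Sym2.ind with
            | _ a b => simp [mem_cr]
          rw [this] at hs'
          simp at hs' hc
          rw [hs'] at ht0
          simp at ht0
          omega
        · have h1 := h (I0.erase u) ((erase_subset _ _).trans hI0N) he
          rw [hout _ (by simp)] at h1
          have h2 : (I0.erase u ∩ B).card ≤ (I0 ∩ B).card :=
            card_le_card (inter_subset_inter_right (erase_subset _ _))
          omega
      obtain ⟨x, y, hxy, hx, hy, hlx, hly, hne⟩ := hedge
      obtain ⟨Z, hZ, h1, h2, h3⟩ := ih hBN (Y.erase x) (by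
        intro I hI hIne
        have hmono := card_le_card (cr_mono G l (erase_subset x Y) I)
        have h5 := h I hI hIne
        by_cases huI : u ∈ I
        · rw [hin I huI] at h5
          by_cases ht : (cr G l Y I).card + 1 = I.card + (I ∩ insert u B).card
          · have hIT : I ∈ T := mem_filter.2 ⟨mem_powerset.2 hI, huI, ht⟩
            have hss := hsub I hIT
            have : cr G l (Y.erase x) I ⊂ cr G l Y I := by
              refine (ssubset_iff_of_subset (cr_mono G l (erase_subset x Y) I)).2 ⟨s(x, y), ?_, ?_⟩
              · rw [mem_cr]
                exact ⟨⟨hxy, hx, hy⟩, ⟨hlx ▸ huI, hss hly⟩, by rw [hlx]; exact hne.symm⟩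
              · rw [mem_cr]; simp
            have := card_lt_card this
            omega
          · rw [hin I huI] at ht
            omega
        · rw [hout I huI] at h5; omega)
      refine ⟨insert x Z, ?_, ?_, ?_, ?_⟩
      · exact insert_subset hx (hZ.trans (erase_subset _ _))
      · intro z hz
        rcases mem_insert.1 hz with rfl | hz
        · rw [hlx]; exact mem_insert_self _ _
        · exact mem_insert_of_mem (h1 z hz)
      · intro z hz z' hz' hzz
        rcases mem_insert.1 hz with hq | hq <;> rcases mem_insert.1 hz' with hq' | hq'
        · rw [hq, hq']
        · exact absurd (h1 z' hq') (by rw [← hzz, hq, hlx]; exact hu)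
        · exact absurd (h1 z hq) (by rw [hzz, hq', hlx]; exact hu)
        · exact h2 z hq z' hq' hzz
      · intro I hI hIne
        have := h3 I hI hIne
        have he : Y \ insert x Z = Y.erase x \ Z := by
          ext w; simp only [mem_sdiff, mem_insert, mem_erase]; tauto
        rwa [he]

end Kill

section ThmN
open scoped Classical
open Finset

variable {V : Type} [Fintype V]

def Good (G : SimpleGraph V) (P : Finset V) : Prop :=
  ∃ S ⊆ P, Forest G (P \ S) ∧ ∃ Q, IsPart Q P ∧ (2 * S.card : ℤ) ≤ ∑ A ∈ Q, wt G A

lemma erase_good {G : SimpleGraph V} {A : Finset V} {u : V} (hu : u ∈ A) (hA : 2 ≤ A.card)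
    (hopt : ∀ R, IsPart R A → Wt G R ≤ Wt G {A}) (ih : Good G (A.erase u)) :
    ∃ T ⊆ A, u ∈ T ∧ Forest G (A \ T) ∧ (2 * T.card : ℤ) ≤ wt G A := by
  obtain ⟨S, hS, hf, R, hR, hle⟩ := ih
  have hd : Disjoint (A.erase u) {u} := by simp
  obtain ⟨h1, h2⟩ := hR.union (isPart_singleton (singleton_nonempty u)) hd
  have he : A.erase u ∪ {u} = A := by
    ext x; by_cases h : x = u <;> simp [h, hu]
  rw [he] at h1
  have hRn : 1 ≤ R.card := by
    rw [Nat.one_le_iff_ne_zero]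
    intro h0
    rw [card_eq_zero] at h0
    have := hR.2.2
    rw [h0] at this
    have h3 := card_erase_of_mem hu
    rw [← this] at h3
    simp at h3
    omega
  have h3 : 2 ≤ (R ∪ {{u}}).card := by
    rw [card_union_of_disjoint h2]; simpa using hRn
  have h4 := sum_lt_of_Wt h3 (hopt _ h1)
  rw [sum_union h2, sum_singleton, wt_singleton] at h4
  refine ⟨insert u S, insert_subset hu (hS.trans (erase_subset _ _)), mem_insert_self _ _, ?_, ?_⟩
  · have : A \ insert u S = A.erase u \ S := by
      ext w; simp only [mem_sdiff, mem_insert, mem_erase]; tauto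
    rwa [this]
  · have := card_insert_le u S
    have h5 : ((insert u S).card : ℤ) ≤ S.card + 1 := by exact_mod_cast this
    linarith

lemma sum_le_of_opt {G : SimpleGraph V} {R Q : Finset (Finset V)} {P : Finset V}
    (hQ : IsPart Q P) (hRn : R.Nonempty) (hw : Wt G R ≤ Wt G Q) :
    ∑ B ∈ R, wt G B ≤ ∑ B ∈ Q, wt G B := by
  rw [Wt_eq, Wt_eq] at hw
  have h1 := hRn.card_pos
  have h2 : (1 : ℤ) ≤ R.card := by exact_mod_cast h1
  have h3 : (Q.card : ℤ) ≤ Fintype.card V := by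
    exact_mod_cast hQ.card_le.trans (card_le_univ _)
  by_contra hlt
  push Not at hlt
  have h4 : (Fintype.card V + 1 : ℤ) * ((∑ A ∈ Q, wt G A) + 1) ≤
      (Fintype.card V + 1 : ℤ) * (∑ A ∈ R, wt G A) :=
    mul_le_mul_of_nonneg_left (by omega) (by positivity)
  linarith

lemma wt_eq_bet (G : SimpleGraph V) (A : Finset V) :
    wt G A = bet G A + if bet G A % 2 = 1 then 1 else 0 := by
  unfold wt; split_ifs <;> omega

lemma merge_cond {G : SimpleGraph V} {Q : Finset (Finset V)} {P : Finset V} (hQ : IsOpt G Q P)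
    (l : V → Finset V) (hl : ∀ A ∈ Q, ∀ x ∈ A, l x = A) (hl' : ∀ x ∈ P, x ∈ l x)
    (I : Finset (Finset V)) (hI : I ⊆ Q) (hne : I.Nonempty) :
    (cr G l P I).card + 1 ≤ I.card + (I ∩ Q.filter (fun A => bet G A % 2 = 1)).card := by
  have hIp := hQ.1.sub hI
  set P' := I.biUnion id with hP'
  have hP'n : P'.Nonempty := by
    obtain ⟨A, hA⟩ := hne
    obtain ⟨x, hx⟩ := hQ.1.nonempty (hI hA)
    exact ⟨x, mem_biUnion.2 ⟨A, hA, hx⟩⟩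
  have hw := sum_le_of_opt hIp (singleton_nonempty P') (hQ.replace hI (isPart_singleton hP'n))
  rw [sum_singleton] at hw
  have hfil : ∀ k ∈ I, P'.filter (fun y => l y = k) = k := by
    intro k hk
    ext x
    simp only [mem_filter, hP', mem_biUnion, id]
    constructor
    · rintro ⟨⟨B, hB, hx⟩, hlx⟩
      rw [hl B (hI hB) x hx] at hlx
      rwa [← hlx]
    · intro hx
      exact ⟨⟨k, hk, hx⟩, hl k (hI hk) x hx⟩
  have hlab : ∀ y ∈ P', l y ∈ I := by
    intro y hy
    obtain ⟨B, hB, hx⟩ := mem_biUnion.1 hy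
    rwa [hl B (hI hB) y hx]
  have h1 := ed_split G l P' I hlab
  have h1s : ∑ k ∈ I, (ed G (P'.filter (fun y => l y = k))).card = ∑ k ∈ I, (ed G k).card :=
    sum_congr rfl (fun k hk => by rw [hfil k hk])
  rw [h1s] at h1
  have h2 : P'.card = ∑ k ∈ I, k.card := by
    rw [hP', card_biUnion]
    · rfl
    · intro A hA B hB hAB
      exact hQ.1.2.1 _ (hI hA) _ (hI hB) hAB
  have h3 : (cr G l P I).card ≤ (cr G l P' I).card := by
    apply card_le_card
    intro e
    induction e using Sym2.ind with
    | _ a b =>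
      simp only [mem_cr]
      rintro ⟨⟨h1, h2, h3⟩, ⟨h4, h5⟩, h6⟩
      exact ⟨⟨h1, mem_biUnion.2 ⟨_, h4, hl' a h2⟩, mem_biUnion.2 ⟨_, h5, hl' b h3⟩⟩, ⟨h4, h5⟩, h6⟩
  have h4 : bet G P' ≤ wt G P' := by rw [wt_eq_bet]; split_ifs <;> omega
  have h5 : ∑ A ∈ I, wt G A = ∑ A ∈ I, bet G A +
      ((I ∩ Q.filter (fun A => bet G A % 2 = 1)).card : ℤ) := by
    rw [sum_congr rfl (fun A _ => wt_eq_bet G A), sum_add_distrib]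
    congr 1
    rw [← sum_filter, sum_const, nsmul_eq_mul, mul_one]
    congr 2
    ext A
    simp only [mem_filter, mem_inter]
    constructor
    · rintro ⟨h, h'⟩; exact ⟨h, hI h, h'⟩
    · rintro ⟨h, _, h'⟩; exact ⟨h, h'⟩
  have h6 : ∑ A ∈ I, bet G A = (∑ A ∈ I, (ed G A).card : ℕ) - (∑ A ∈ I, A.card : ℕ) + I.card := by
    simp [bet, sum_add_distrib, sum_sub_distrib]
  unfold bet at h4
  omega

theorem good_all (G : SimpleGraph V) : ∀ (n : ℕ) (P : Finset V), P.card = n → Good G P := by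
  intro n
  induction n using Nat.strong_induction_on with
  | _ n ih =>
  intro P hPn
  rcases P.eq_empty_or_nonempty with rfl | hPne
  · refine ⟨∅, by simp, ?_, ∅, by simp [IsPart], by simp⟩
    intro Y hY hYn
    simp at hY; subst hY; simp at hYn
  obtain ⟨Q, hQ⟩ := exists_opt G P
  by_cases hQP : Q = {P}
  · subst hQP
    by_cases h1 : P.card = 1
    · refine ⟨∅, by simp, ?_, {P}, hQ.1, ?_⟩
      · obtain ⟨v, rfl⟩ := card_eq_one.1 h1
        intro Y hY hYn
        simp at hY
        rcases hY with rfl | rfl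
        · simp at hYn
        · simp [ed_singleton]
      · obtain ⟨v, rfl⟩ := card_eq_one.1 h1
        simp [wt_singleton]
    · obtain ⟨u, hu⟩ := hPne
      have h2 : 2 ≤ P.card := by
        have := card_pos.2 ⟨u, hu⟩; omega
      have h3 := card_erase_of_mem hu
      obtain ⟨T, hT, _, hf, hle⟩ := erase_good hu h2 hQ.2 (ih (P.card - 1) (by omega) _ h3)
      exact ⟨T, hT, hf, {P}, hQ.1, by simpa using hle⟩
  · have hsm : ∀ A ∈ Q, A.card < n := by
      intro A hA
      rw [← hPn]
      apply card_lt_card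
      refine (hQ.1.subset hA).ssubset_of_ne ?_
      rintro rfl
      apply hQP
      ext B
      rw [mem_singleton]
      constructor
      · intro hB
        by_contra hne
        obtain ⟨x, hx⟩ := hQ.1.nonempty hB
        exact Finset.disjoint_left.1 (hQ.1.2.1 _ hB _ hA hne) hx (hQ.1.subset hB hx)
      · rintro rfl; exact hA
    have hex : ∀ x, ∃ A, x ∈ P → A ∈ Q ∧ x ∈ A := by
      intro x
      by_cases hx : x ∈ P
      · have := hQ.1.2.2
        rw [← this] at hx
        obtain ⟨A, hA, hxA⟩ := mem_biUnion.1 hx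
        exact ⟨A, fun _ => ⟨hA, hxA⟩⟩
      · exact ⟨∅, fun h => absurd h hx⟩
    choose l hl0 using hex
    have hl' : ∀ x ∈ P, x ∈ l x := fun x hx => (hl0 x hx).2
    have hl : ∀ A ∈ Q, ∀ x ∈ A, l x = A := by
      intro A hA x hx
      obtain ⟨h1, h2⟩ := hl0 x (hQ.1.subset hA hx)
      by_contra hne
      exact Finset.disjoint_left.1 (hQ.1.2.1 _ h1 _ hA hne) h2 hx
    obtain ⟨Z, hZP, hZB, hZi, hZ⟩ := kill G l Q (Q.filter (fun A => bet G A % 2 = 1))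
      (filter_subset _ _) P (fun I hI hne => merge_cond hQ l hl hl' I hI hne)
    have hT : ∀ A ∈ Q, ∃ T ⊆ A, Z ∩ A ⊆ T ∧ Forest G (A \ T) ∧ (2 * T.card : ℤ) ≤ wt G A := by
      intro A hA
      have hopt : ∀ R, IsPart R A → Wt G R ≤ Wt G {A} := fun R hR => hQ.replace1 hA hR
      rcases (Z ∩ A).eq_empty_or_nonempty with he | ⟨u, hu⟩
      · obtain ⟨S, hS, hf, R, hR, hle⟩ := ih A.card (hsm A hA) A rfl
        exact ⟨S, hS, by simp [he], hf, hle.trans (sum_le_of_Wt hR (hQ.1.nonempty hA) (hopt R hR))⟩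
      · rw [mem_inter] at hu
        have hodd := (mem_filter.1 (hZB u hu.1)).2
        rw [hl A hA u hu.2] at hodd
        have h2 : 2 ≤ A.card := by
          by_contra hlt
          have h1 : A.card = 1 := by
            have := card_pos.2 ⟨u, hu.2⟩; omega
          obtain ⟨v, rfl⟩ := card_eq_one.1 h1
          simp [bet, ed_singleton] at hodd
        have h3 := card_erase_of_mem hu.2
        obtain ⟨T, hT, huT, hf, hle⟩ := erase_good hu.2 h2 hopt
          (ih (A.card - 1) (by have := hsm A hA; omega) _ h3)
        refine ⟨T, hT, ?_, hf, hle⟩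
        intro w hw
        rw [mem_inter] at hw
        rw [hZi w hw.1 u hu.1 ((hl A hA w hw.2).trans (hl A hA u hu.2).symm)]
        exact huT
    choose! T hTA hTZ hTf hTle using hT
    refine ⟨Q.biUnion T, ?_, ?_, Q, hQ.1, ?_⟩
    · intro x hx
      obtain ⟨A, hA, hxA⟩ := mem_biUnion.1 hx
      exact hQ.1.subset hA (hTA A hA hxA)
    · intro Y hY hYn
      have hYP : ∀ y ∈ Y, y ∈ P := fun y hy => (mem_sdiff.1 (hY hy)).1
      have hYT : ∀ y ∈ Y, y ∉ T (l y) := fun y hy h =>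
        (mem_sdiff.1 (hY hy)).2 (mem_biUnion.2 ⟨l y, (hl0 y (hYP y hy)).1, h⟩)
      have hIQ : Y.image l ⊆ Q := by
        intro A hA
        obtain ⟨y, hy, rfl⟩ := mem_image.1 hA
        exact (hl0 y (hYP y hy)).1
      have h1 := ed_split G l Y (Y.image l) (fun y hy => mem_image_of_mem l hy)
      have h2 := hZ (Y.image l) hIQ (hYn.image l)
      have h3 : (cr G l Y (Y.image l)).card ≤ (cr G l (P \ Z) (Y.image l)).card := by
        apply card_le_card
        apply cr_mono
        intro y hy
        rw [mem_sdiff]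
        refine ⟨hYP y hy, fun hyZ => hYT y hy ?_⟩
        exact hTZ _ (hl0 y (hYP y hy)).1 (mem_inter.2 ⟨hyZ, hl' y (hYP y hy)⟩)
      have h4 : ∑ k ∈ Y.image l, ((ed G (Y.filter (fun y => l y = k))).card + 1) ≤
          ∑ k ∈ Y.image l, (Y.filter (fun y => l y = k)).card := by
        apply sum_le_sum
        intro k hk
        obtain ⟨y, hy, rfl⟩ := mem_image.1 hk
        apply hTf (l y) (hIQ hk)
        · intro z hz
          rw [mem_filter] at hz
          rw [mem_sdiff, ← hz.2]
          exact ⟨hl' z (hYP z hz.1), hYT z hz.1⟩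
        · exact ⟨y, by simp [hy]⟩
      rw [← card_eq_sum_card_image, sum_add_distrib, sum_const, smul_eq_mul, mul_one] at h4
      omega
    · have h1 : (Q.biUnion T).card ≤ ∑ A ∈ Q, (T A).card := card_biUnion_le
      have h2 : ((Q.biUnion T).card : ℤ) ≤ ∑ A ∈ Q, ((T A).card : ℤ) := by exact_mod_cast h1
      have h3 : ∑ A ∈ Q, (2 * (T A).card : ℤ) ≤ ∑ A ∈ Q, wt G A := sum_le_sum hTle
      rw [← mul_sum] at h3
      linarith

theorem phi_le_opt (G : SimpleGraph V) (Q : Finset (Finset V)) (hQ : IsOpt G Q univ) (hne : Nonempty V) :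
    (2 * phi G : ℤ) ≤ ∑ A ∈ Q, wt G A := by
  obtain ⟨S, hS, hf, R, hR, hle⟩ := good_all G _ univ rfl
  have h1 := phi_le_of_forest G S (by rwa [compl_eq_univ_sdiff])
  have h2 : R.Nonempty := by
    rw [nonempty_iff_ne_empty]; rintro rfl
    have := hR.2.2; simp at this
    exact (univ_nonempty (α := V)).ne_empty this.symm
  have h3 := sum_le_of_opt hQ.1 h2 (hQ.2 R hR)
  have h4 : (phi G : ℤ) ≤ S.card := by exact_mod_cast h1
  linarith

end ThmN

section FMember
open scoped Classical
open Finset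

variable {V : Type} [Fintype V]

/-- the induced subgraph on `X` is in the family -/
def InF (i j : ℕ) (H : SimpleGraph V) (X : Finset V) : Prop := IsInF i j (H.induce (X : Set V))

lemma inF_of_map {i j : ℕ} {W : Type} {K : SimpleGraph W} {H : SimpleGraph V} {X : Finset V}
    (f : W → V) (hinj : Function.Injective f) (hX : ∀ x, x ∈ X ↔ ∃ w, f w = x)
    (hadj : ∀ a b, H.Adj (f a) (f b) ↔ K.Adj a b) (hK : IsInF i j K) : InF i j H X := by
  let g : W → (X : Set V) := fun w => ⟨f w, by
    rw [Finset.mem_coe, hX]; exact ⟨w, rfl⟩⟩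
  have hg : Function.Bijective g := by
    constructor
    · intro a b hab
      exact hinj (congrArg Subtype.val hab)
    · rintro ⟨x, hx⟩
      rw [Finset.mem_coe, hX] at hx
      obtain ⟨w, hw⟩ := hx
      exact ⟨w, Subtype.ext hw⟩
  let e : K ≃g H.induce (X : Set V) :=
    { toEquiv := Equiv.ofBijective g hg
      map_rel_iff' := by
        intro a b
        exact hadj a b }
  exact IsInF.iso ⟨e.symm⟩ hK

/-- `s` has exactly the two nonadjacent neighbours `p`, `q` in `X`. -/
def Sm (H : SimpleGraph V) (X : Finset V) (s p q : V) : Prop :=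
  s ∈ X ∧ p ∈ X ∧ q ∈ X ∧ p ≠ q ∧ H.Adj s p ∧ H.Adj s q ∧
    (∀ z ∈ X, H.Adj s z → z = p ∨ z = q) ∧ ¬ H.Adj p q

lemma smooth {i j : ℕ} {H : SimpleGraph V} {X : Finset V} {s p q : V} (h : Sm H X s p q)
    (hF : InF i j (H ⊔ edge p q) (X.erase s)) : InF (i + 1) j H X := by
  obtain ⟨hs, hp, hq, hpq, hsp, hsq, hn, hna⟩ := h
  have hpX : p ∈ ((X.erase s : Finset V) : Set V) := by
    simp [hp, hsp.ne']
  have hqX : q ∈ ((X.erase s : Finset V) : Set V) := by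
    simp [hq, hsq.ne']
  have hadj : ((H ⊔ edge p q).induce ((X.erase s : Finset V) : Set V)).Adj ⟨p, hpX⟩ ⟨q, hqX⟩ := by
    simp [edge_adj, hpq]
  have hK : IsInF (i + 1) j (subdivideEdge
      ((H ⊔ edge p q).induce ((X.erase s : Finset V) : Set V)) ⟨p, hpX⟩ ⟨q, hqX⟩) :=
    IsInF.subdiv hadj hF
  refine inF_of_map (fun o => Option.elim o s (fun y : ((X.erase s : Finset V) : Set V) => (y : V))) ?_ ?_ ?_ hK
  · rintro (_ | ⟨a, ha⟩) (_ | ⟨b, hb⟩) hab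
    · rfl
    · simp at hab hb; exact absurd hab.symm hb.2
    · simp at hab ha; exact absurd hab ha.2
    · simp at hab; simp [hab]
  · intro x
    constructor
    · intro hx
      by_cases hxs : x = s
      · exact ⟨none, hxs.symm⟩
      · exact ⟨some ⟨x, by simp [hx, hxs]⟩, rfl⟩
    · rintro ⟨(_ | ⟨a, ha⟩), rfl⟩
      · exact hs
      · simp at ha; exact ha.1
  · rintro (_ | ⟨a, ha⟩) (_ | ⟨b, hb⟩)
    · simp [subdivideEdge]
    · simp only [subdivideEdge, fromRel_adj, Option.elim]
      simp at hb
      constructor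
      · intro hab
        have := hn b hb.1 hab
        simpa using this
      · simp
        rintro (rfl | rfl) <;> assumption
    · simp only [subdivideEdge, fromRel_adj, Option.elim]
      simp at ha
      constructor
      · intro hab
        have := hn a ha.1 hab.symm
        simpa using this
      · simp
        rintro (rfl | rfl)
        · exact hsp.symm
        · exact hsq.symm
    · simp only [subdivideEdge, fromRel_adj, Option.elim]
      simp at ha hb
      simp only [Option.some.injEq, Subtype.mk.injEq, reduceCtorEq, false_and, or_false,
        ne_eq, comap_adj, Function.Embedding.subtype_apply, sup_adj, edge_adj, Sym2.eq_iff]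
      constructor
      · intro hab
        refine ⟨hab.ne, Or.inl ⟨⟨a, by simp [ha]⟩, ⟨b, by simp [hb]⟩, rfl, rfl, Or.inl hab, ?_⟩⟩
        simp
        refine ⟨?_, ?_⟩
        · rintro rfl rfl; exact hna hab
        · rintro rfl rfl; exact hna hab.symm
      · rintro ⟨hne, (⟨x, y, rfl, rfl, h1, h2⟩ | ⟨x, y, rfl, rfl, h1, h2⟩)⟩
        · simp at h1 h2
          rcases h1 with h1 | ⟨h1, h3⟩
          · exact h1
          · rcases h1 with ⟨rfl, rfl⟩ | ⟨rfl, rfl⟩ <;> simp at h2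
        · simp at h1 h2
          rcases h1 with h1 | ⟨h1, h3⟩
          · exact h1.symm
          · rcases h1 with ⟨rfl, rfl⟩ | ⟨rfl, rfl⟩ <;> simp at h2

lemma hasDegreeTwo_of_dg {H : SimpleGraph V} {X : Finset V} {a : V} (ha : a ∈ X)
    (h : dg H X a = 2) : HasDegreeTwo (H.induce (X : Set V)) ⟨a, ha⟩ := by
  unfold dg at h
  obtain ⟨x, y, hxy, he⟩ := card_eq_two.1 h
  have hx : x ∈ X.filter (H.Adj a) := by rw [he]; simp
  have hy : y ∈ X.filter (H.Adj a) := by rw [he]; simp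
  rw [mem_filter] at hx hy
  refine ⟨⟨x, hx.1⟩, ⟨y, hy.1⟩, ?_, hx.2, hy.2, ?_⟩
  · simpa using hxy
  · rintro ⟨z, hz⟩ hz'
    have : z ∈ X.filter (H.Adj a) := mem_filter.2 ⟨hz, hz'⟩
    rw [he] at this
    simpa using this

set_option maxHeartbeats 1000000 in
lemma op_lem {i j : ℕ} {H : SimpleGraph V} {X : Finset V} {v a s₁ s₂ p₁ q₁ p₂ q₂ : V}
    (hv : v ∈ X) (haX : a ∈ X) (ha1 : a ≠ s₁) (ha2 : a ≠ s₂) (h12 : s₁ ≠ s₂)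
    (hva : H.Adj v a) (hv1 : H.Adj v s₁) (hv2 : H.Adj v s₂)
    (hn : ∀ z ∈ X, H.Adj v z → z = a ∨ z = s₁ ∨ z = s₂)
    (h1 : Sm H (X.erase v) s₁ p₁ q₁)
    (h2 : Sm (H ⊔ edge p₁ q₁) ((X.erase v).erase s₁) s₂ p₂ q₂)
    (hp1 : p₁ ≠ s₂) (hq1 : q₁ ≠ s₂)
    (hd : dg (H ⊔ edge p₁ q₁ ⊔ edge p₂ q₂) (((X.erase v).erase s₁).erase s₂) a = 2)
    (hF : InF i j (H ⊔ edge p₁ q₁ ⊔ edge p₂ q₂) (((X.erase v).erase s₁).erase s₂)) :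
    InF i (j + 1) H X := by
  obtain ⟨g1, g2, g3, g4, g5, g6, g7, g8⟩ := h1
  obtain ⟨k1, k2, k3, k4, k5, k6, k7, k8⟩ := h2
  simp only [mem_erase] at g1 g2 g3 k1 k2 k3
  have hs1 : s₁ ≠ p₁ := g5.ne
  have hs1' : s₁ ≠ q₁ := g6.ne
  have hs2 : s₂ ≠ p₂ := k5.ne
  have hs2' : s₂ ≠ q₂ := k6.ne
  have k5' : H.Adj s₂ p₂ := by
    rcases k5 with h | h
    · exact h
    · rw [edge_adj] at h
      rcases h.1 with ⟨h, _⟩ | ⟨h, _⟩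
      · exact absurd h.symm hp1
      · exact absurd h.symm hq1
  have k6' : H.Adj s₂ q₂ := by
    rcases k6 with h | h
    · exact h
    · rw [edge_adj] at h
      rcases h.1 with ⟨h, _⟩ | ⟨h, _⟩
      · exact absurd h.symm hp1
      · exact absurd h.symm hq1
  have k7' : ∀ z ∈ X, z ≠ v → z ≠ s₁ → H.Adj s₂ z → z = p₂ ∨ z = q₂ := by
    intro z hz hzv hz1 h
    exact k7 z (by simp [hz, hzv, hz1]) (Or.inl h)
  have g7' : ∀ z ∈ X, z ≠ v → H.Adj s₁ z → z = p₁ ∨ z = q₁ := by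
    intro z hz hzv h
    exact g7 z (by simp [hz, hzv]) h
  have h12n : ¬ H.Adj s₁ s₂ := by
    intro h
    rcases g7' s₂ k1.2.2 k1.2.1 h with h | h
    · exact hp1 h.symm
    · exact hq1 h.symm
  have k8' : ¬ H.Adj p₂ q₂ := fun h => k8 (Or.inl h)
  have kpq : ¬ (p₁ = p₂ ∧ q₁ = q₂) := by
    rintro ⟨rfl, rfl⟩
    exact k8 (Or.inr (by simp [edge_adj, g4]))
  have kpq' : ¬ (p₁ = q₂ ∧ q₁ = p₂) := by
    rintro ⟨rfl, rfl⟩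
    exact k8 (Or.inr (by simp [edge_adj, g4.symm]))
  set X' := ((X.erase v).erase s₁).erase s₂ with hX'
  have mX' : ∀ z, z ∈ (X' : Set V) ↔ z ≠ s₂ ∧ z ≠ s₁ ∧ z ≠ v ∧ z ∈ X := by
    intro z; rw [Finset.mem_coe, hX']; simp only [mem_erase]
  have hp1X : p₁ ∈ (X' : Set V) := (mX' _).2 ⟨hp1, hs1.symm, g2.1, g2.2⟩
  have hq1X : q₁ ∈ (X' : Set V) := (mX' _).2 ⟨hq1, hs1'.symm, g3.1, g3.2⟩
  have hp2X : p₂ ∈ (X' : Set V) := (mX' _).2 ⟨hs2.symm, k2.1, k2.2.1, k2.2.2⟩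
  have hq2X : q₂ ∈ (X' : Set V) := (mX' _).2 ⟨hs2'.symm, k3.1, k3.2.1, k3.2.2⟩
  have haX' : a ∈ (X' : Set V) := (mX' _).2 ⟨ha2, ha1, hva.ne', haX⟩
  set H' := (H ⊔ edge p₁ q₁ ⊔ edge p₂ q₂).induce (X' : Set V) with hH'
  have hcirc : IsCircOp H' ⟨a, haX'⟩
      (circOpTwo H' ⟨p₁, hp1X⟩ ⟨q₁, hq1X⟩ ⟨p₂, hp2X⟩ ⟨q₂, hq2X⟩ ⟨a, haX'⟩) := by
    refine Or.inl ⟨_, _, _, _, ?_, ?_, ?_, rfl⟩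
    · simp [hH', edge_adj, g4]
    · simp [hH', edge_adj, k4]
    · simp only [ne_eq, Sym2.eq_iff, Subtype.mk.injEq]; tauto
  refine inF_of_map (fun o => Sum.elim (fun y : (X' : Set V) => (y : V)) ![s₁, s₂, v] o) ?_ ?_ ?_
    (IsInF.op (hasDegreeTwo_of_dg haX' hd) hcirc hF)
  · rintro (⟨x, hx⟩ | x) (⟨y, hy⟩ | y) hxy
    · simp at hxy; simp [hxy]
    · rw [mX'] at hx
      fin_cases y <;> simp at hxy <;> tauto
    · rw [mX'] at hy
      fin_cases x <;> simp at hxy <;> subst hxy <;> tauto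
    · have n1 := g1.1
      have n2 := k1.2.1
      fin_cases x <;> fin_cases y <;> simp at hxy ⊢
      all_goals first | exact h12 hxy | exact h12 hxy.symm | exact n1 hxy | exact n1 hxy.symm | exact n2 hxy | exact n2 hxy.symm
  · intro x
    constructor
    · intro hx
      by_cases h1 : x = s₁
      · exact ⟨Sum.inr 0, h1.symm⟩
      by_cases h2 : x = s₂
      · exact ⟨Sum.inr 1, h2.symm⟩
      by_cases h3 : x = v
      · exact ⟨Sum.inr 2, h3.symm⟩
      exact ⟨Sum.inl ⟨x, (mX' x).2 ⟨h2, h1, h3, hx⟩⟩, rfl⟩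
    · rintro ⟨(⟨y, hy⟩ | y), rfl⟩
      · exact ((mX' y).1 hy).2.2.2
      · fin_cases y
        · exact g1.2
        · exact k1.2.2
        · exact hv
  · have side : ∀ (x : V) (hx : x ∈ (X' : Set V)) (y : Fin 3),
        H.Adj x (![s₁, s₂, v] y) ↔ (circOpTwo H' ⟨p₁, hp1X⟩ ⟨q₁, hq1X⟩ ⟨p₂, hp2X⟩ ⟨q₂, hq2X⟩
          ⟨a, haX'⟩).Adj (Sum.inl ⟨x, hx⟩) (Sum.inr y) := by
      intro x hx y
      have hx' := (mX' x).1 hx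
      fin_cases y
      · simp [circOpTwo]
        constructor
        · intro h; exact g7' x hx'.2.2.2 hx'.2.2.1 h.symm
        · rintro (rfl | rfl)
          · exact g5.symm
          · exact g6.symm
      · simp [circOpTwo]
        constructor
        · intro h; exact k7' x hx'.2.2.2 hx'.2.2.1 hx'.2.1 h.symm
        · rintro (rfl | rfl)
          · exact k5'.symm
          · exact k6'.symm
      · simp [circOpTwo]
        constructor
        · intro h
          rcases hn x hx'.2.2.2 h.symm with h | h | h
          · exact h
          · exact absurd h hx'.2.1
          · exact absurd h hx'.1
        · rintro rfl
          exact hva.symm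
    rintro (⟨x, hx⟩ | x) (⟨y, hy⟩ | y)
    · simp only [circOpTwo, fromRel_adj, Sum.elim_inl]
      constructor
      · intro hab
        refine ⟨by simpa using hab.ne, Or.inl (Or.inl ⟨⟨x, hx⟩, ⟨y, hy⟩, rfl, rfl, Or.inl (Or.inl hab), ?_, ?_⟩)⟩
        · simp only [ne_eq, Sym2.eq_iff, Subtype.mk.injEq]
          rintro (⟨rfl, rfl⟩ | ⟨rfl, rfl⟩)
          · exact g8 hab
          · exact g8 hab.symm
        · simp only [ne_eq, Sym2.eq_iff, Subtype.mk.injEq]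
          rintro (⟨rfl, rfl⟩ | ⟨rfl, rfl⟩)
          · exact k8' hab
          · exact k8' hab.symm
      · have key : ∀ x y : (X' : Set V), H'.Adj x y → s(x, y) ≠ s(⟨p₁, hp1X⟩, ⟨q₁, hq1X⟩) →
            s(x, y) ≠ s(⟨p₂, hp2X⟩, ⟨q₂, hq2X⟩) → H.Adj x y := by
          rintro ⟨x, hx⟩ ⟨y, hy⟩ h1 h2 h3
          simp only [ne_eq, Sym2.eq_iff, Subtype.mk.injEq] at h2 h3
          simp [hH', edge_adj] at h1
          rcases h1 with (h1 | h1) | h1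
          · exact h1
          · exact absurd h1.1 h2
          · exact absurd h1.1 h3
        simp only [Sum.inl.injEq, reduceCtorEq, false_and, or_false]
        rintro ⟨_, (⟨p, q, rfl, rfl, h1, h2, h3⟩ | ⟨p, q, rfl, rfl, h1, h2, h3⟩)⟩
        · exact key _ _ h1 h2 h3
        · exact (key _ _ h1 h2 h3).symm
    · exact side x hx y
    · rw [SimpleGraph.adj_comm, SimpleGraph.adj_comm (circOpTwo _ _ _ _ _ _)]
      exact side y hy x
    · have n12 : ¬ H.Adj s₂ s₁ := fun h => h12n h.symm
      have a1 := hv1.symm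
      have a2 := hv2.symm
      fin_cases x <;> fin_cases y <;> simp [circOpTwo] <;> assumption

end FMember

section FMember2
open scoped Classical
open Finset

variable {V : Type} [Fintype V]

lemma dg_two {H : SimpleGraph V} {X : Finset V} {a : V} (h : dg H X a = 2) :
    ∃ p q, p ∈ X ∧ q ∈ X ∧ p ≠ q ∧ H.Adj a p ∧ H.Adj a q ∧
      ∀ z ∈ X, H.Adj a z → z = p ∨ z = q := by
  unfold dg at h
  obtain ⟨x, y, hxy, he⟩ := card_eq_two.1 h
  have hx : x ∈ X.filter (H.Adj a) := by rw [he]; simp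
  have hy : y ∈ X.filter (H.Adj a) := by rw [he]; simp
  rw [mem_filter] at hx hy
  refine ⟨x, y, hx.1, hy.1, hxy, hx.2, hy.2, fun z hz hz' => ?_⟩
  have : z ∈ X.filter (H.Adj a) := mem_filter.2 ⟨hz, hz'⟩
  rw [he] at this
  simpa using this

lemma dg_three {H : SimpleGraph V} {X : Finset V} {a : V} (h : dg H X a = 3) :
    ∃ p q r, p ∈ X ∧ q ∈ X ∧ r ∈ X ∧ p ≠ q ∧ p ≠ r ∧ q ≠ r ∧ H.Adj a p ∧ H.Adj a q ∧ H.Adj a r ∧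
      ∀ z ∈ X, H.Adj a z → z = p ∨ z = q ∨ z = r := by
  unfold dg at h
  obtain ⟨x, y, w, hxy, hxw, hyw, he⟩ := card_eq_three.1 h
  have hx : x ∈ X.filter (H.Adj a) := by rw [he]; simp
  have hy : y ∈ X.filter (H.Adj a) := by rw [he]; simp
  have hw : w ∈ X.filter (H.Adj a) := by rw [he]; simp
  rw [mem_filter] at hx hy hw
  refine ⟨x, y, w, hx.1, hy.1, hw.1, hxy, hxw, hyw, hx.2, hy.2, hw.2, fun z hz hz' => ?_⟩
  have : z ∈ X.filter (H.Adj a) := mem_filter.2 ⟨hz, hz'⟩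
  rw [he] at this
  simpa using this

lemma dg_three_of {H : SimpleGraph V} {X : Finset V} {a v : V} (h : dg H X a = 3) (hv : v ∈ X)
    (hav : H.Adj a v) : ∃ p q, p ∈ X ∧ q ∈ X ∧ p ≠ q ∧ p ≠ v ∧ q ≠ v ∧ H.Adj a p ∧ H.Adj a q ∧
      ∀ z ∈ X, H.Adj a z → z = v ∨ z = p ∨ z = q := by
  obtain ⟨p, q, r, h1, h2, h3, h4, h5, h6, h7, h8, h9, h10⟩ := dg_three h
  rcases h10 v hv hav with rfl | rfl | rfl
  · exact ⟨q, r, h2, h3, h6, h4.symm, h5.symm, h8, h9, h10⟩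
  · exact ⟨p, r, h1, h3, h5, h4, h6.symm, h7, h9, fun z hz hz' => by
      have := h10 z hz hz'; tauto⟩
  · exact ⟨p, q, h1, h2, h4, h5, h6, h7, h8, fun z hz hz' => by
      have := h10 z hz hz'; tauto⟩

lemma dg_ge {H : SimpleGraph V} {X : Finset V} {a : V} (S : Finset V) (hS : ∀ z ∈ S, z ∈ X ∧ H.Adj a z) :
    S.card ≤ dg H X a :=
  card_le_card fun z hz => mem_filter.2 (hS z hz)

lemma dg_ge3 {H : SimpleGraph V} {X : Finset V} {a x y z : V} (hx : x ∈ X) (hy : y ∈ X) (hz : z ∈ X)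
    (hxy : x ≠ y) (hxz : x ≠ z) (hyz : y ≠ z) (ax : H.Adj a x) (ay : H.Adj a y) (az : H.Adj a z) :
    3 ≤ dg H X a := by
  rw [← card_eq_three.2 ⟨x, y, z, hxy, hxz, hyz, rfl⟩]
  apply dg_ge
  simp only [mem_insert, mem_singleton]
  rintro w (rfl | rfl | rfl) <;> constructor <;> assumption

lemma dg_ge4 {H : SimpleGraph V} {X : Finset V} {a x y z t : V} (hx : x ∈ X) (hy : y ∈ X) (hz : z ∈ X)
    (ht : t ∈ X) (hxy : x ≠ y) (hxz : x ≠ z) (hyz : y ≠ z) (htx : t ≠ x) (hty : t ≠ y) (htz : t ≠ z)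
    (ax : H.Adj a x) (ay : H.Adj a y) (az : H.Adj a z) (at' : H.Adj a t) :
    4 ≤ dg H X a := by
  have h3 : ({x, y, z} : Finset V).card = 3 := card_eq_three.2 ⟨x, y, z, hxy, hxz, hyz, rfl⟩
  have : (insert t ({x, y, z} : Finset V)).card = 4 := by
    rw [card_insert_of_notMem, h3]
    simp [htx, hty, htz]
  rw [← this]
  apply dg_ge
  simp only [mem_insert, mem_singleton]
  rintro w (rfl | rfl | rfl | rfl) <;> constructor <;> assumption

/-- if the neighbours of `u` are confined to a set of size at most its degree, all are neighbours -/
lemma adj_of_dg {H : SimpleGraph V} {X : Finset V} {u : V} (S : Finset V)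
    (hS : ∀ z ∈ X, H.Adj u z → z ∈ S) (hc : S.card ≤ dg H X u) : ∀ z ∈ S, H.Adj u z := by
  have h1 : X.filter (H.Adj u) ⊆ S := fun z hz => hS z (mem_filter.1 hz).1 (mem_filter.1 hz).2
  have h2 := eq_of_subset_of_card_le h1 hc
  intro z hz
  rw [← h2] at hz
  exact (mem_filter.1 hz).2

lemma dg_erase_adj {H : SimpleGraph V} {X : Finset V} {v x : V} (hv : v ∈ X) (h : H.Adj x v) :
    dg H (X.erase v) x + 1 = dg H X x := by
  unfold dg
  rw [filter_erase, card_erase_add_one]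
  exact mem_filter.2 ⟨hv, h⟩

lemma dg_erase_not {H : SimpleGraph V} {X : Finset V} {v x : V} (h : ¬ H.Adj x v) :
    dg H (X.erase v) x = dg H X x := by
  unfold dg
  rw [filter_erase, erase_eq_of_notMem]
  simp [h]

lemma Sm.symm {H : SimpleGraph V} {X : Finset V} {s p q : V} (h : Sm H X s p q) : Sm H X s q p := by
  obtain ⟨h1, h2, h3, h4, h5, h6, h7, h8⟩ := h
  exact ⟨h1, h3, h2, h4.symm, h6, h5, fun z hz hz' => (h7 z hz hz').symm, fun h => h8 h.symm⟩

lemma dg_eq_card {H : SimpleGraph V} {X S : Finset V} {a : V}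
    (h : ∀ z, z ∈ S ↔ z ∈ X ∧ H.Adj a z) : dg H X a = S.card := by
  unfold dg
  congr 1
  ext z
  rw [mem_filter, h]

lemma Sm.dg_left {H : SimpleGraph V} {X : Finset V} {s p q : V} (h : Sm H X s p q) :
    dg (H ⊔ edge p q) (X.erase s) p = dg H X p := by
  obtain ⟨h1, h2, h3, h4, h5, h6, h7, h8⟩ := h
  rw [dg_eq_card (S := insert q ((X.filter (fun y => H.Adj p y)).erase s)),
    card_insert_of_notMem, card_erase_add_one, dg_eq_card]
  · intro z; rw [mem_filter]
  · exact mem_filter.2 ⟨h1, h5.symm⟩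
  · simp [h8]
  · intro z
    simp only [mem_filter, mem_erase, mem_insert, sup_adj, edge_adj]
    constructor
    · rintro (rfl | ⟨ha, hb, hc⟩)
      · exact ⟨⟨h6.ne', h3⟩, Or.inr ⟨Or.inl (by simp), h4⟩⟩
      · exact ⟨⟨ha, hb⟩, Or.inl hc⟩
    · rintro ⟨⟨ha, hb⟩, (hc | hc)⟩
      · exact Or.inr ⟨ha, hb, hc⟩
      · left
        rcases hc.1 with hc | hc
        · exact hc.2
        · exact absurd hc.1 h4

lemma Sm.dg_eq {H : SimpleGraph V} {X : Finset V} {s p q : V} (h : Sm H X s p q) {x : V} (hx : x ∈ X)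
    (hxs : x ≠ s) : dg (H ⊔ edge p q) (X.erase s) x = dg H X x := by
  by_cases hp : x = p
  · subst hp; exact h.dg_left
  by_cases hq : x = q
  · subst hq
    rw [edge_comm]; exact h.symm.dg_left
  obtain ⟨h1, h2, h3, h4, h5, h6, h7, h8⟩ := h
  unfold dg
  congr 1
  ext z
  simp only [mem_filter, mem_erase, sup_adj, edge_adj]
  constructor
  · rintro ⟨⟨ha, hb⟩, (hc | hc)⟩
    · exact ⟨hb, hc⟩
    · tauto
  · rintro ⟨ha, hb⟩
    refine ⟨⟨?_, ha⟩, Or.inl hb⟩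
    rintro rfl
    rcases h7 x hx hb.symm with h | h
    · exact hp h
    · exact hq h

def TF (H : SimpleGraph V) (X : Finset V) : Prop :=
  ∀ a ∈ X, ∀ b ∈ X, ∀ c ∈ X, H.Adj a b → H.Adj b c → H.Adj a c → False

lemma smooth_tf {H : SimpleGraph V} {X : Finset V} {s : V} (hs : s ∈ X) (hd : dg H X s = 2)
    (htf : ∀ p ∈ X, ∀ q ∈ X, H.Adj s p → H.Adj s q → ¬ H.Adj p q) :
    ∃ H' : SimpleGraph V, (∀ i j, InF i j H' (X.erase s) → InF (i + 1) j H X) ∧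
      (∀ x ∈ X, x ≠ s → dg H' (X.erase s) x = dg H X x) ∧
      (∀ a b, H'.Adj a b → H.Adj a b ∨ (H.Adj s a ∧ H.Adj s b)) := by
  obtain ⟨p, q, hp, hq, hpq, hsp, hsq, hn⟩ := dg_two hd
  have hsm : Sm H X s p q := ⟨hs, hp, hq, hpq, hsp, hsq, hn, htf p hp q hq hsp hsq⟩
  refine ⟨H ⊔ edge p q, fun i j h => smooth hsm h, fun x hx hxs => hsm.dg_eq hx hxs, ?_⟩
  intro a b hab
  rw [sup_adj, edge_adj] at hab
  rcases hab with hab | ⟨⟨rfl, rfl⟩ | ⟨rfl, rfl⟩, _⟩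
  · exact Or.inl hab
  · exact Or.inr ⟨hsp, hsq⟩
  · exact Or.inr ⟨hsq, hsp⟩

lemma op_tf {H : SimpleGraph V} {X : Finset V} {v x y z : V} (htf : TF H X)
    (hv : v ∈ X) (hx : x ∈ X) (hy : y ∈ X) (hz : z ∈ X) (hxy : x ≠ y) (hxz : x ≠ z) (hyz : y ≠ z)
    (avx : H.Adj v x) (avy : H.Adj v y) (avz : H.Adj v z)
    (hn : ∀ w ∈ X, H.Adj v w → w = x ∨ w = y ∨ w = z)
    (dx : dg H X x = 3) (dy : dg H X y = 3) (dz : dg H X z = 3)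
    (hw : ∃ w ∈ X, H.Adj y w ∧ ¬ H.Adj z w) :
    ∃ (H' : SimpleGraph V) (X' : Finset V), X'.card + 3 = X.card ∧
      (∀ w, w ∈ X' ↔ w ∈ X ∧ w ≠ v ∧ w ≠ y ∧ w ≠ z) ∧
      (∀ i j, InF i j H' X' → InF i (j + 1) H X) ∧
      dg H' X' x = 2 ∧ (∀ w ∈ X', w ≠ x → dg H' X' w = dg H X w) ∧
      (∀ a b, H'.Adj a b → H.Adj a b ∨ (H.Adj y a ∧ H.Adj y b) ∨ (H.Adj z a ∧ H.Adj z b)) := by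
  obtain ⟨p₁, q₁, hp1, hq1, hpq1, hp1v, hq1v, yp1, yq1, hn1⟩ := dg_three_of dy hv avy.symm
  obtain ⟨p₂, q₂, hp2, hq2, hpq2, hp2v, hq2v, zp2, zq2, hn2⟩ := dg_three_of dz hv avz.symm
  have nyz : ¬ H.Adj y z := fun h => htf v hv y hy z hz avy h avz
  have hp1z : p₁ ≠ z := by rintro rfl; exact nyz yp1
  have hq1z : q₁ ≠ z := by rintro rfl; exact nyz yq1
  have hp2y : p₂ ≠ y := by rintro rfl; exact nyz zp2.symm
  have hq2y : q₂ ≠ y := by rintro rfl; exact nyz zq2.symm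
  have h1 : Sm H (X.erase v) y p₁ q₁ := by
    refine ⟨by simp [hy, avy.ne'], by simp [hp1, hp1v], by simp [hq1, hq1v], hpq1, yp1, yq1, ?_, ?_⟩
    · intro w hw haw
      rw [mem_erase] at hw
      rcases hn1 w hw.2 haw with h | h
      · exact absurd h hw.1
      · exact h
    · intro h; exact htf y hy p₁ hp1 q₁ hq1 yp1 h yq1
  have h2 : Sm (H ⊔ edge p₁ q₁) ((X.erase v).erase y) z p₂ q₂ := by
    refine ⟨by simp [hz, avz.ne', hyz.symm], by simp [hp2, hp2v, hp2y], by simp [hq2, hq2v, hq2y],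
      hpq2, Or.inl zp2, Or.inl zq2, ?_, ?_⟩
    · intro w hw haw
      rw [mem_erase, mem_erase] at hw
      rw [sup_adj, edge_adj] at haw
      rcases haw with haw | haw
      · rcases hn2 w hw.2.2 haw with h | h
        · exact absurd h hw.2.1
        · exact h
      · rcases haw.1 with h | h
        · exact absurd h.1.symm hp1z
        · exact absurd h.1.symm hq1z
    · rw [sup_adj, edge_adj]
      rintro (h | h)
      · exact htf z hz p₂ hp2 q₂ hq2 zp2 h zq2
      · obtain ⟨w, hwX, hyw, hzw⟩ := hw
        rcases h.1 with ⟨rfl, rfl⟩ | ⟨rfl, rfl⟩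
        · rcases hn1 w hwX hyw with rfl | rfl | rfl
          · exact hzw avz.symm
          · exact hzw zp2
          · exact hzw zq2
        · rcases hn1 w hwX hyw with rfl | rfl | rfl
          · exact hzw avz.symm
          · exact hzw zq2
          · exact hzw zp2
  have hdg : ∀ w ∈ X, w ≠ v → w ≠ y → w ≠ z →
      dg (H ⊔ edge p₁ q₁ ⊔ edge p₂ q₂) (((X.erase v).erase y).erase z) w = dg H (X.erase v) w := by
    intro w hw hwv hwy hwz
    rw [h2.dg_eq (by simp [hw, hwv, hwy]) hwz, h1.dg_eq (by simp [hw, hwv]) hwy]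
  have hdx : dg (H ⊔ edge p₁ q₁ ⊔ edge p₂ q₂) (((X.erase v).erase y).erase z) x = 2 := by
    rw [hdg x hx avx.ne' hxy hxz]
    have := dg_erase_adj hv avx.symm
    omega
  refine ⟨H ⊔ edge p₁ q₁ ⊔ edge p₂ q₂, ((X.erase v).erase y).erase z, ?_, ?_, ?_, hdx, ?_, ?_⟩
  · have e1 := card_erase_add_one hv
    have e2 := card_erase_add_one h1.1
    have e3 := card_erase_add_one h2.1
    omega
  · intro w
    simp only [mem_erase]; tauto
  · intro i j h
    exact op_lem hv hx hxy hxz hyz avx avy avz hn h1 h2 hp1z hq1z hdx h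
  · intro w hw hwx
    simp only [mem_erase] at hw
    rw [hdg w hw.2.2.2 hw.2.2.1 hw.2.1 hw.1, dg_erase_not]
    intro h
    rcases hn w hw.2.2.2 h.symm with h | h | h
    · exact hwx h
    · exact hw.2.1 h
    · exact hw.1 h
  · intro a b hab
    rw [sup_adj, sup_adj, edge_adj, edge_adj] at hab
    rcases hab with (hab | ⟨⟨rfl, rfl⟩ | ⟨rfl, rfl⟩, _⟩) | ⟨⟨rfl, rfl⟩ | ⟨rfl, rfl⟩, _⟩
    · exact Or.inl hab
    · exact Or.inr (Or.inl ⟨yp1, yq1⟩)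
    · exact Or.inr (Or.inl ⟨yq1, yp1⟩)
    · exact Or.inr (Or.inr ⟨zp2, zq2⟩)
    · exact Or.inr (Or.inr ⟨zq2, zp2⟩)

lemma base4 {H : SimpleGraph V} {X : Finset V} (hX : X.card = 4) (hd : ∀ x ∈ X, dg H X x = 3) :
    InF 1 1 H X := by
  have hadj : ∀ x ∈ X, ∀ y ∈ X, x ≠ y → H.Adj x y := by
    intro x hx y hy hxy
    refine adj_of_dg (X := X) (X.erase x) (fun z hz hxz => by simp [hz, hxz.ne']) ?_ y (by simp [hy, hxy.symm])
    have := card_erase_add_one hx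
    rw [hd x hx]; omega
  let e : Fin 4 ≃ X := (Fintype.equivFinOfCardEq (by simpa using hX)).symm
  refine inF_of_map (fun i => (e i : V)) ?_ ?_ ?_ IsInF.k4
  · intro a b hab
    exact e.injective (Subtype.ext hab)
  · intro x
    constructor
    · intro hx; exact ⟨e.symm ⟨x, hx⟩, by simp⟩
    · rintro ⟨i, rfl⟩; exact (e i).2
  · intro a b
    rw [top_adj]
    constructor
    · rintro h rfl; exact H.irrefl h
    · intro h
      exact hadj _ (e a).2 _ (e b).2 (fun h' => h (e.injective (Subtype.ext h')))

lemma base5 {H : SimpleGraph V} {X : Finset V} (hX : X.card = 5) {q : V} (hq : q ∈ X)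
    (hdq : dg H X q = 2) (hd : ∀ x ∈ X, x ≠ q → dg H X x = 3) : InF 2 1 H X := by
  obtain ⟨H', h1, h2, h3⟩ := smooth_tf hq hdq (by
    intro s hs t ht qs qt hst
    have hall : ∀ r ∈ X, r ≠ q → r ≠ s → r ≠ t → H.Adj r s := by
      intro r hr hrq hrs hrt
      have hnq : ¬ H.Adj r q := by
        intro h
        have := dg_ge3 hs ht hr hst.ne hrs.symm hrt.symm qs qt h.symm
        omega
      refine adj_of_dg (X := X) ((X.erase q).erase r) ?_ ?_ s (by simp [hs, qs.ne', hrs.symm])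
      · intro z hz hrz
        simp only [mem_erase]
        refine ⟨hrz.ne', ?_, hz⟩
        rintro rfl; exact hnq hrz
      · have e1 := card_erase_add_one hq
        have e2 := card_erase_add_one (show r ∈ X.erase q by simp [hr, hrq])
        rw [hd r hr hrq]; omega
    have h4 := dg_ge (H := H) (X := X) (a := s) (X.erase s) (by
      intro z hz
      rw [mem_erase] at hz
      refine ⟨hz.2, ?_⟩
      by_cases hzq : z = q
      · subst hzq; exact qs.symm
      by_cases hzt : z = t
      · subst hzt; exact hst
      exact (hall z hz.2 hzq hz.1 hzt).symm)
    have e1 := card_erase_add_one hs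
    have := hd s hs qs.ne'
    omega)
  have e1 := card_erase_add_one hq
  refine h1 1 1 (base4 (by omega) ?_)
  intro x hx
  rw [mem_erase] at hx
  rw [h2 x hx.2 hx.1, hd x hx.2 hx.1]

end FMember2

section FMember3
open scoped Classical
open Finset

variable {V : Type} [Fintype V]

def Twin (H : SimpleGraph V) (X : Finset V) (s t : V) : Prop :=
  ∃ p ∈ X, ∃ q ∈ X, p ≠ q ∧ H.Adj s p ∧ H.Adj s q ∧ H.Adj t p ∧ H.Adj t q

lemma Twin.symm {H : SimpleGraph V} {X : Finset V} {s t : V} (h : Twin H X s t) : Twin H X t s := by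
  obtain ⟨p, hp, q, hq, h1, h2, h3, h4, h5⟩ := h
  exact ⟨p, hp, q, hq, h1, h4, h5, h2, h3⟩

lemma l79a {H : SimpleGraph V} {X : Finset V} (hX : X.card = 7) (htf : TF H X) {r s t : V}
    (hr : r ∈ X) (hs : s ∈ X) (ht : t ∈ X) (hrs : r ≠ s) (hrt : r ≠ t) (hst : s ≠ t)
    (dr : dg H X r = 2) (ds : dg H X s = 2) (dt : dg H X t = 2)
    (hd : ∀ x ∈ X, x ≠ r → x ≠ s → x ≠ t → dg H X x = 3)
    (hb : ¬ Twin H X s t) (hb' : ¬ H.Adj s t) : InF 4 1 H X := by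
  obtain ⟨H₁, f1, g1, k1⟩ := smooth_tf hs ds (fun p hp q hq h1 h2 h3 => htf s hs p hp q hq h1 h3 h2)
  have ht1 : t ∈ X.erase s := by simp [ht, hst.symm]
  have kt : ∀ w, H₁.Adj t w → H.Adj t w := by
    intro w hw
    rcases k1 t w hw with h | h
    · exact h
    · exact absurd h.1 hb'
  obtain ⟨H₂, f2, g2, k2⟩ := smooth_tf ht1 ((g1 t ht hst.symm).trans dt) (by
    intro p hp q hq h1 h2 h3
    rw [mem_erase] at hp hq
    rcases k1 p q h3 with h | h
    · exact htf t ht p hp.2 q hq.2 (kt p h1) h (kt q h2)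
    · exact hb ⟨p, hp.2, q, hq.2, h3.ne, h.1, h.2, kt p h1, kt q h2⟩)
  refine f1 3 1 (f2 2 1 (base5 ?_ (q := r) ?_ ?_ ?_))
  · have e1 := card_erase_add_one hs
    have e2 := card_erase_add_one ht1
    omega
  · simp [hr, hrs, hrt]
  · rw [g2 r (by simp [hr, hrs]) hrt, g1 r hr hrs, dr]
  · intro x hx hxr
    simp only [mem_erase] at hx
    rw [g2 x (by simp [hx]) hx.1, g1 x hx.2.2 hx.2.1, hd x hx.2.2 hxr hx.2.1 hx.1]

lemma card_sdiff_list {X : Finset V} (S : Finset V) (hS : S ⊆ X) : (X \ S).card + S.card = X.card :=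
  card_sdiff_add_card_eq_card hS

set_option maxHeartbeats 1000000 in
lemma l79b {H : SimpleGraph V} {X : Finset V} (hX : X.card = 7) (htf : TF H X) {r s t : V}
    (hr : r ∈ X) (hs : s ∈ X) (ht : t ∈ X) (hrs : r ≠ s) (hrt : r ≠ t) (hst : s ≠ t)
    (dr : dg H X r = 2) (ds : dg H X s = 2) (dt : dg H X t = 2)
    (hd : ∀ x ∈ X, x ≠ r → x ≠ s → x ≠ t → dg H X x = 3)
    (hb : Twin H X s t) (hb' : Twin H X r s ∨ H.Adj r s) : False := by
  obtain ⟨p, hp, q, hq, hpq, sp, sq, tp, tq⟩ := hb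
  have ns : ∀ z ∈ X, H.Adj s z → z = p ∨ z = q := by
    intro z hz hsz
    by_contra h
    push Not at h
    have := dg_ge3 hp hq hz hpq h.1.symm h.2.symm sp sq hsz
    omega
  have nt : ∀ z ∈ X, H.Adj t z → z = p ∨ z = q := by
    intro z hz hsz
    by_contra h
    push Not at h
    have := dg_ge3 hp hq hz hpq h.1.symm h.2.symm tp tq hsz
    omega
  by_cases hrs' : H.Adj r s
  · -- `r` is one of `p`, `q`
    obtain ⟨o, ho, hro, so, at2⟩ : ∃ o ∈ X, r ≠ o ∧ H.Adj s o ∧ H.Adj t o ∧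
        (∀ z ∈ X, H.Adj s z → z = r ∨ z = o) ∧ (∀ z ∈ X, H.Adj t z → z = r ∨ z = o) ∧
        H.Adj t r := by
      rcases ns r hr hrs'.symm with rfl | rfl
      · exact ⟨q, hq, hpq, sq, tq, ns, nt, tp⟩
      · exact ⟨p, hp, hpq.symm, sp, tp, fun z hz h => (ns z hz h).symm,
          fun z hz h => (nt z hz h).symm, tq⟩
    obtain ⟨at2, ns, nt, tr⟩ := at2
    have nr : ∀ z ∈ X, H.Adj r z → z = s ∨ z = t := by
      intro z hz hsz
      by_contra h
      push Not at h
      have := dg_ge3 hs ht hz hst h.1.symm h.2.symm hrs' tr.symm hsz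
      omega
    have hos : o ≠ s := so.ne'
    have hot : o ≠ t := at2.ne'
    -- every remaining vertex is adjacent at2 everything else remaining
    have key : ∀ u ∈ X, u ≠ r → u ≠ s → u ≠ t → u ≠ o →
        ∀ z ∈ X, z ≠ r → z ≠ s → z ≠ t → z ≠ u → H.Adj u z := by
      intro u hu ur us ut uo z hz zr zs zt zu
      refine adj_of_dg (X := X) (X \ {r, s, t, u}) ?_ ?_ z (by simp [hz, zr, zs, zt, zu])
      · intro w hw huw
        simp only [mem_sdiff, mem_insert, mem_singleton, not_or]
        refine ⟨hw, ?_, ?_, ?_, huw.ne'⟩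
        · rintro rfl; rcases nr u hu huw.symm with h | h
          · exact us h
          · exact ut h
        · rintro rfl; rcases ns u hu huw.symm with h | h
          · exact ur h
          · exact uo h
        · rintro rfl; rcases nt u hu huw.symm with h | h
          · exact ur h
          · exact uo h
      · rw [hd u hu ur us ut]
        have e := card_sdiff_list (X := X) {r, s, t, u} (by
          intro w; simp only [mem_insert, mem_singleton]
          rintro (rfl | rfl | rfl | rfl) <;> assumption)
        have e2 : ({r, s, t, u} : Finset V).card = 4 := by
          rw [card_insert_of_notMem, card_insert_of_notMem, card_insert_of_notMem, card_singleton]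
          all_goals simp only [mem_insert, mem_singleton, not_or]
          all_goals grind
        omega
    have e2 : ({r, s, t, o} : Finset V).card ≤ 4 := card_le_four
    have e := card_sdiff_list (X := X) {r, s, t, o} (by
          intro w; simp only [mem_insert, mem_singleton]
          rintro (rfl | rfl | rfl | rfl) <;> assumption)
    obtain ⟨u, hu, w, hw, huw⟩ := one_lt_card.1 (show 1 < (X \ {r, s, t, o}).card by omega)
    simp only [mem_sdiff, mem_insert, mem_singleton, not_or] at hu hw
    obtain ⟨hu, u1, u2, u3, u4⟩ := hu
    obtain ⟨hw, w1, w2, w3, w4⟩ := hw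
    exact htf u hu w hw o ho (key u hu u1 u2 u3 u4 w hw w1 w2 w3 huw.symm)
      (key w hw w1 w2 w3 w4 o ho hro.symm hos hot (Ne.symm w4))
      (key u hu u1 u2 u3 u4 o ho hro.symm hos hot (Ne.symm u4))
  · rcases hb' with hb' | hb'
    · obtain ⟨p', hp', q', hq', hpq', rp', rq', sp', sq'⟩ := hb'
      have hrpq : H.Adj r p ∧ H.Adj r q := by
        rcases ns p' hp' sp' with rfl | rfl <;> rcases ns q' hq' sq' with rfl | rfl
        · exact absurd rfl hpq'
        · exact ⟨rp', rq'⟩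
        · exact ⟨rq', rp'⟩
        · exact absurd rfl hpq'
      obtain ⟨rp, rq⟩ := hrpq
      have nr : ∀ z ∈ X, H.Adj r z → z = p ∨ z = q := by
        intro z hz hsz
        by_contra h
        push Not at h
        have := dg_ge3 hp hq hz hpq h.1.symm h.2.symm rp rq hsz
        omega
      have pr : p ≠ r := rp.ne'
      have ps : p ≠ s := sp.ne'
      have pt : p ≠ t := tp.ne'
      have qr : q ≠ r := rq.ne'
      have qs : q ≠ s := sq.ne'
      have qt : q ≠ t := tq.ne'
      have np : ∀ z ∈ X, H.Adj p z → z = r ∨ z = s ∨ z = t := by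
        intro z hz h
        by_contra hno
        push Not at hno
        have := dg_ge4 hr hs ht hz hrs hrt hst hno.1 hno.2.1 hno.2.2 rp.symm sp.symm tp.symm h
        have := hd p hp pr ps pt
        omega
      have nq : ∀ z ∈ X, H.Adj q z → z = r ∨ z = s ∨ z = t := by
        intro z hz h
        by_contra hno
        push Not at hno
        have := dg_ge4 hr hs ht hz hrs hrt hst hno.1 hno.2.1 hno.2.2 rq.symm sq.symm tq.symm h
        have := hd q hq qr qs qt
        omega
      have hsub : ({r, s, t, p, q} : Finset V) ⊆ X := by
        intro w; simp only [mem_insert, mem_singleton]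
        rintro (rfl | rfl | rfl | rfl | rfl) <;> assumption
      have e := card_sdiff_list (X := X) _ hsub
      have e2 : ({r, s, t, p, q} : Finset V).card ≤ 5 := card_le_five
      have e3 : ({r, s, t, p, q} : Finset V).card = 5 := by
        rw [card_insert_of_notMem, card_insert_of_notMem, card_insert_of_notMem,
          card_insert_of_notMem, card_singleton]
        all_goals simp only [mem_insert, mem_singleton, not_or]
        all_goals grind
      obtain ⟨u, hu0⟩ := card_pos.1 (show 0 < (X \ {r, s, t, p, q}).card by omega)
      have hu := hu0
      simp only [mem_sdiff, mem_insert, mem_singleton, not_or] at hu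
      obtain ⟨hu, u1, u2, u3, u4, u5⟩ := hu
      have h3 := hd u hu u1 u2 u3
      obtain ⟨a, b, c, ha, hb, hc, hab, hac, hbc, ua, ub, uc, -⟩ := dg_three h3
      have hin : ∀ z ∈ X, H.Adj u z → z ∈ X \ {r, s, t, p, q} := by
        intro z hz huz
        simp only [mem_sdiff, mem_insert, mem_singleton, not_or]
        refine ⟨hz, ?_, ?_, ?_, ?_, ?_⟩
        · rintro rfl; rcases nr u hu huz.symm with h | h <;> contradiction
        · rintro rfl; rcases ns u hu huz.symm with h | h <;> contradiction
        · rintro rfl; rcases nt u hu huz.symm with h | h <;> contradiction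
        · rintro rfl; rcases np u hu huz.symm with h | h | h <;> contradiction
        · rintro rfl; rcases nq u hu huz.symm with h | h | h <;> contradiction
      have h4 : ({a, b, c} : Finset V) ⊆ X \ {r, s, t, p, q} := by
        intro w; simp only [mem_insert, mem_singleton]
        rintro (rfl | rfl | rfl)
        · exact hin _ ha ua
        · exact hin _ hb ub
        · exact hin _ hc uc
      have h5 := card_le_card h4
      rw [card_eq_three.2 ⟨a, b, c, hab, hac, hbc, rfl⟩] at h5
      omega
    · exact hrs' hb'

lemma l79 {H : SimpleGraph V} {X : Finset V} (hX : X.card = 7) (htf : TF H X) {r s t : V}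
    (hr : r ∈ X) (hs : s ∈ X) (ht : t ∈ X) (hrs : r ≠ s) (hrt : r ≠ t) (hst : s ≠ t)
    (dr : dg H X r = 2) (ds : dg H X s = 2) (dt : dg H X t = 2)
    (hd : ∀ x ∈ X, x ≠ r → x ≠ s → x ≠ t → dg H X x = 3) : InF 4 1 H X := by
  by_cases h1 : ¬ Twin H X s t ∧ ¬ H.Adj s t
  · exact l79a hX htf hr hs ht hrs hrt hst dr ds dt hd h1.1 h1.2
  by_cases h2 : ¬ Twin H X r s ∧ ¬ H.Adj r s
  · exact l79a hX htf ht hr hs hrt.symm hst.symm hrs dt dr ds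
      (fun x hx a b c => hd x hx b c a) h2.1 h2.2
  by_cases h3 : ¬ Twin H X r t ∧ ¬ H.Adj r t
  · exact l79a hX htf hs hr ht hrs.symm hst hrt ds dr dt
      (fun x hx a b c => hd x hx b a c) h3.1 h3.2
  exfalso
  by_cases k1 : Twin H X s t
  · exact l79b hX htf hr hs ht hrs hrt hst dr ds dt hd k1 (by tauto)
  by_cases k2 : Twin H X r s
  · exact l79b hX htf ht hr hs hrt.symm hst.symm hrs dt dr ds
      (fun x hx a b c => hd x hx b c a) k2 (by
        rcases not_and_or.1 h3 with h | h
        · exact Or.inl (not_not.1 h).symm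
        · exact Or.inr (not_not.1 h).symm)
  by_cases k3 : Twin H X r t
  · exact l79b hX htf hs hr ht hrs.symm hst hrt ds dr dt
      (fun x hx a b c => hd x hx b a c) k3 (by
        rcases not_and_or.1 h2 with h | h
        · exact Or.inl (not_not.1 h).symm
        · exact Or.inr (not_not.1 h).symm)
  exact htf r hr s hs t ht (by tauto) (by tauto) (by tauto)

set_option maxHeartbeats 1000000 in
lemma jlem {H : SimpleGraph V} {X : Finset V} (hX : X.card = 8) (htf : TF H X)
    (hd : ∀ x ∈ X, dg H X x = 3) : InF 2 2 H X := by
  obtain ⟨v, hv⟩ := card_pos.1 (show 0 < X.card by omega)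
  obtain ⟨x, y, z, hx, hy, hz, hxy, hxz, hyz, vx, vy, vz, hn⟩ := dg_three (hd v hv)
  have fin : ∀ x y z : V, x ∈ X → y ∈ X → z ∈ X → x ≠ y → x ≠ z → y ≠ z → H.Adj v x → H.Adj v y →
      H.Adj v z → (∀ w ∈ X, H.Adj v w → w = x ∨ w = y ∨ w = z) →
      (∃ w ∈ X, H.Adj y w ∧ ¬ H.Adj z w) → InF 2 2 H X := by
    intro x y z hx hy hz hxy hxz hyz vx vy vz hn hw
    obtain ⟨H', X', hc, hm, hf, hdx, hdw, -⟩ := op_tf htf hv hx hy hz hxy hxz hyz vx vy vz hn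
      (hd x hx) (hd y hy) (hd z hz) hw
    refine hf 2 1 (base5 (by omega) (q := x) ((hm x).2 ⟨hx, vx.ne', hxy, hxz⟩) hdx ?_)
    intro w hw hwx
    rw [hdw w hw hwx]
    exact hd w ((hm w).1 hw).1
  by_cases h1 : ∃ w ∈ X, H.Adj y w ∧ ¬ H.Adj z w
  · exact fin x y z hx hy hz hxy hxz hyz vx vy vz hn h1
  by_cases h2 : ∃ w ∈ X, H.Adj z w ∧ ¬ H.Adj x w
  · exact fin y z x hy hz hx hyz hxy.symm hxz.symm vy vz vx
      (fun w hw h => by have := hn w hw h; tauto) h2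
  by_cases h3 : ∃ w ∈ X, H.Adj x w ∧ ¬ H.Adj y w
  · exact fin z x y hz hx hy hxz.symm hyz.symm hxy vz vx vy
      (fun w hw h => by have := hn w hw h; tauto) h3
  exfalso
  push Not at h1 h2 h3
  obtain ⟨a, b, ha, hb, hab, hav, hbv, xa, xb, hnx⟩ := dg_three_of (hd x hx) hv vx.symm
  have ya := h3 a ha xa
  have yb := h3 b hb xb
  have za := h1 a ha ya
  have zb := h1 b hb yb
  have nin : ∀ c ∈ X, H.Adj x c → ∀ u ∈ X, H.Adj c u → u = x ∨ u = y ∨ u = z := by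
    intro c hc xc u hu cu
    by_contra hno
    push Not at hno
    have yc := h3 c hc xc
    have zc := h1 c hc yc
    have := dg_ge4 hx hy hz hu hxy hxz hyz hno.1 hno.2.1 hno.2.2 xc.symm yc.symm zc.symm cu
    have := hd c hc
    omega
  have hsub : ({v, a, b, x, y, z} : Finset V) ⊆ X := by
    intro w; simp only [mem_insert, mem_singleton]
    rintro (rfl | rfl | rfl | rfl | rfl | rfl) <;> assumption
  have e := card_sdiff_list (X := X) _ hsub
  have e3 : ({v, a, b, x, y, z} : Finset V).card = 6 := by
    have := vx.ne
    have := vy.ne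
    have := vz.ne
    have := xa.ne
    have := ya.ne
    have := za.ne
    have := xb.ne
    have := yb.ne
    have := zb.ne
    rw [card_insert_of_notMem, card_insert_of_notMem, card_insert_of_notMem,
          card_insert_of_notMem, card_insert_of_notMem, card_singleton]
    all_goals simp only [mem_insert, mem_singleton, not_or]
    all_goals grind
  obtain ⟨u, hu0⟩ := card_pos.1 (show 0 < (X \ {v, a, b, x, y, z}).card by omega)
  have hu := hu0
  simp only [mem_sdiff, mem_insert, mem_singleton, not_or] at hu
  obtain ⟨hu, u1, u2, u3, u4, u5, u6⟩ := hu
  obtain ⟨a', b', c', ha', hb', hc', hab', hac', hbc', ua, ub, uc, -⟩ := dg_three (hd u hu)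
  have hin : ∀ w ∈ X, H.Adj u w → w ∈ X \ {v, a, b, x, y, z} := by
    intro w hw huw
    have hxn : ∀ u ∈ X, H.Adj x u → u = v ∨ u = a ∨ u = b := hnx
    simp only [mem_sdiff, mem_insert, mem_singleton, not_or]
    refine ⟨hw, ?_, ?_, ?_, ?_, ?_, ?_⟩
    · rintro rfl; rcases hn u hu huw.symm with h | h | h <;> contradiction
    · rintro rfl; rcases nin w hw xa u hu huw.symm with h | h | h <;> contradiction
    · rintro rfl; rcases nin w hw xb u hu huw.symm with h | h | h <;> contradiction
    · rintro rfl; rcases hnx u hu huw.symm with h | h | h <;> contradiction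
    · rintro rfl; rcases hnx u hu (h2 u hu (h1 u hu huw.symm)) with h | h | h <;> contradiction
    · rintro rfl; rcases hnx u hu (h2 u hu huw.symm) with h | h | h <;> contradiction
  have h4 : ({a', b', c'} : Finset V) ⊆ X \ {v, a, b, x, y, z} := by
    intro w; simp only [mem_insert, mem_singleton]
    rintro (rfl | rfl | rfl)
    · exact hin _ ha' ua
    · exact hin _ hb' ub
    · exact hin _ hc' uc
  have h5 := card_le_card h4
  rw [card_eq_three.2 ⟨a', b', c', hab', hac', hbc', rfl⟩] at h5
  omega

end FMember3

section FMember4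
open scoped Classical
open Finset

variable {V : Type} [Fintype V]

/-- no four-cycles inside `X` -/
def QF (H : SimpleGraph V) (X : Finset V) : Prop :=
  ∀ a ∈ X, ∀ c ∈ X, ∀ b ∈ X, ∀ d ∈ X, a ≠ c → b ≠ d → H.Adj a b → H.Adj a d → H.Adj c b →
    H.Adj c d → False

lemma tf_of {H J : SimpleGraph V} {X' C : Finset V}
    (h0 : TF H X')
    (hJ : ∀ a ∈ X', ∀ b ∈ X', J.Adj a b → H.Adj a b ∨ ∃ c ∈ C, H.Adj c a ∧ H.Adj c b)
    (h4 : ∀ c ∈ C, ∀ a ∈ X', ∀ b ∈ X', ∀ w ∈ X', a ≠ b → H.Adj c a → H.Adj c b → H.Adj w a →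
      H.Adj w b → False)
    (h3 : ∀ c ∈ C, ∀ a ∈ X', ∀ b ∈ X', ∀ w ∈ X', a ≠ b → a ≠ w → b ≠ w → H.Adj c a → H.Adj c b →
      H.Adj c w → False)
    (hcc : ∀ c ∈ C, ∀ c' ∈ C, c ≠ c' → ∀ w ∈ X', ∀ a ∈ X', ∀ b ∈ X', w ≠ a → w ≠ b → a ≠ b →
      H.Adj c w → H.Adj c' w → H.Adj c a → H.Adj c' b →
      (H.Adj a b ∨ ∃ c'' ∈ C, c'' ≠ c ∧ c'' ≠ c' ∧ H.Adj c'' a ∧ H.Adj c'' b) → False) :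
    TF J X' := by
  intro a ha b hb c hc jab jbc jac
  have nab := jab.ne
  have nac := jac.ne
  have nbc := jbc.ne
  rcases hJ a ha b hb jab with h1 | ⟨k, hk, h1, h1'⟩ <;>
  rcases hJ b hb c hc jbc with h2 | ⟨l, hl, h2, h2'⟩ <;>
  rcases hJ a ha c hc jac with h5 | ⟨m, hm, h5, h5'⟩
  · exact h0 a ha b hb c hc h1 h2 h5
  · exact h4 m hm a ha c hc b hb nac h5 h5' h1.symm h2
  · exact h4 l hl b hb c hc a ha nbc h2 h2' h1 h5
  · by_cases e : l = m
    · subst e; exact h3 l hl a ha b hb c hc nab nac nbc h5 h2 h5'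
    · exact hcc l hl m hm e c hc b hb a ha nbc.symm nac.symm nab.symm h2' h5' h2 h5 (Or.inl h1.symm)
  · exact h4 k hk a ha b hb c hc nab h1 h1' h5.symm h2.symm
  · by_cases e : k = m
    · subst e; exact h3 k hk a ha b hb c hc nab nac nbc h1 h1' h5'
    · exact hcc k hk m hm e a ha b hb c hc nab nac nbc h1 h5 h1' h5' (Or.inl h2)
  · by_cases e : k = l
    · subst e; exact h3 k hk a ha b hb c hc nab nac nbc h1 h1' h2'
    · exact hcc k hk l hl e b hb a ha c hc nab.symm nbc nac h1' h2 h1 h2' (Or.inl h5)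
  · by_cases e : k = l
    · subst e; exact h3 k hk a ha b hb c hc nab nac nbc h1 h1' h2'
    by_cases e2 : k = m
    · subst e2; exact h3 k hk a ha b hb c hc nab nac nbc h1 h1' h5'
    by_cases e3 : l = m
    · subst e3; exact h3 l hl a ha b hb c hc nab nac nbc h5 h2 h5'
    · exact hcc k hk l hl e b hb a ha c hc nab.symm nbc nac h1' h2 h1 h2'
        (Or.inr ⟨m, hm, fun h => e2 h.symm, fun h => e3 h.symm, h5, h5'⟩)

lemma alpha {H : SimpleGraph V} {X : Finset V} (hX : X.card = 10) (htf : TF H X) (hqf : QF H X)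
    {p q : V} (hp : p ∈ X) (hq : q ∈ X) (hpq : p ≠ q) (dp : dg H X p = 2) (dq : dg H X q = 2)
    (hd : ∀ x ∈ X, x ≠ p → x ≠ q → dg H X x = 3) : InF 4 2 H X := by
  obtain ⟨v, hv, hvT⟩ : ∃ v ∈ X, v ∉ insert p (insert q (X.filter (fun w => H.Adj p w) ∪
      X.filter (fun w => H.Adj q w))) := by
    by_contra hno
    push Not at hno
    have h1 := card_le_card (show X ⊆ _ from hno)
    have h2 := card_insert_le p (insert q (X.filter (fun w => H.Adj p w) ∪
      X.filter (fun w => H.Adj q w)))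
    have h3 := card_insert_le q (X.filter (fun w => H.Adj p w) ∪
      X.filter (fun w => H.Adj q w))
    have h4 := card_union_le (X.filter (fun w => H.Adj p w)) (X.filter (fun w => H.Adj q w))
    unfold dg at dp dq
    omega
  simp only [mem_insert, mem_union, mem_filter, not_or, not_and] at hvT
  obtain ⟨vp, vq, npv, nqv⟩ := hvT
  have npv := npv hv
  have nqv := nqv hv
  obtain ⟨x, y, z, hx, hy, hz, hxy, hxz, hyz, vx, vy, vz, hn⟩ := dg_three (hd v hv vp vq)
  have ne : ∀ w, H.Adj v w → w ≠ p ∧ w ≠ q := by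
    intro w hw
    exact ⟨by rintro rfl; exact npv hw.symm, by rintro rfl; exact nqv hw.symm⟩
  have dx := hd x hx (ne x vx).1 (ne x vx).2
  have dy := hd y hy (ne y vy).1 (ne y vy).2
  have dz := hd z hz (ne z vz).1 (ne z vz).2
  have hw : ∃ w ∈ X, H.Adj y w ∧ ¬ H.Adj z w := by
    obtain ⟨a, b, ha, hb, hab, hav, hbv, ya, yb, -⟩ := dg_three_of dy hv vy.symm
    exact ⟨a, ha, ya, fun h => hqf y hy z hz v hv a ha hyz hav.symm vy.symm ya vz.symm h⟩
  obtain ⟨J, X', hc, hm, hf, hdx, hdw, hJ⟩ := op_tf htf hv hx hy hz hxy hxz hyz vx vy vz hn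
    dx dy dz hw
  have hsub : ∀ w ∈ X', w ∈ X := fun w h => ((hm w).1 h).1
  have hxp := ne x vx
  have hp' : p ∈ X' := (hm p).2 ⟨hp, Ne.symm vp, (ne y vy).1.symm, (ne z vz).1.symm⟩
  have hq' : q ∈ X' := (hm q).2 ⟨hq, Ne.symm vq, (ne y vy).2.symm, (ne z vz).2.symm⟩
  have hx' : x ∈ X' := (hm x).2 ⟨hx, vx.ne', hxy, hxz⟩
  have hC : ∀ c ∈ ({y, z} : Finset V), c ∈ X ∧ c ∉ X' ∧ H.Adj v c ∧ dg H X c = 3 := by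
    intro c hc
    simp only [mem_insert, mem_singleton] at hc
    rcases hc with rfl | rfl
    · exact ⟨hy, fun h => ((hm _).1 h).2.2.1 rfl, vy, dy⟩
    · exact ⟨hz, fun h => ((hm _).1 h).2.2.2 rfl, vz, dz⟩
  have tf' : TF J X' := by
    apply tf_of (H := H) (C := {y, z})
    · intro a ha b hb c hc; exact htf a (hsub a ha) b (hsub b hb) c (hsub c hc)
    · intro a ha b hb h
      rcases hJ a b h with h | h | h
      · exact Or.inl h
      · exact Or.inr ⟨y, by simp, h⟩
      · exact Or.inr ⟨z, by simp, h⟩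
    · intro c hc a ha b hb w hw hab ca cb wa wb
      obtain ⟨h1, h2, -⟩ := hC c hc
      exact hqf c h1 w (hsub w hw) a (hsub a ha) b (hsub b hb) (by rintro rfl; exact h2 hw) hab
        ca cb wa wb
    · intro c hc a ha b hb w hw hab haw hbw ca cb cw
      obtain ⟨h1, h2, h3, h4⟩ := hC c hc
      have nv : ∀ u ∈ X', v ≠ u := fun u hu h => ((hm u).1 hu).2.1 h.symm
      have := dg_ge4 (hsub a ha) (hsub b hb) (hsub w hw) hv hab haw hbw (nv a ha) (nv b hb) (nv w hw)
        ca cb cw h3.symm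
      omega
    · intro c hc c' hc' hne w hw a ha b hb _ _ _ cw cw' _ _ _
      obtain ⟨h1, -, h3, -⟩ := hC c hc
      obtain ⟨h1', -, h3', -⟩ := hC c' hc'
      exact hqf c h1 c' h1' v hv w (hsub w hw) hne (fun h => ((hm w).1 hw).2.1 h.symm)
        h3.symm cw h3'.symm cw'
  refine hf 4 1 (l79 (by omega) tf' hp' hq' hx' hpq hxp.1.symm hxp.2.symm ?_ ?_ hdx ?_)
  · rw [hdw p hp' hxp.1.symm, dp]
  · rw [hdw q hq' hxp.2.symm, dq]
  · intro w hw h1 h2 h3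
    rw [hdw w hw h3, hd w (hsub w hw) h1 h2]

lemma beta_choose {H : SimpleGraph V} {X : Finset V} (hX : X.card = 13) (htf : TF H X)
    {p p1 p2 : V} (hp : p ∈ X) (hp1 : p1 ∈ X) (hp2 : p2 ∈ X) (pp1 : H.Adj p p1) (pp2 : H.Adj p p2)
    (hd : ∀ x ∈ X, x ≠ p → dg H X x = 3) :
    ∃ v ∈ X, v ≠ p ∧ v ≠ p1 ∧ v ≠ p2 ∧ ¬ H.Adj p1 v ∧ ¬ H.Adj p2 v ∧
      ∀ c ∈ X, ∀ b ∈ X, c ≠ p → b ≠ p → H.Adj v c → H.Adj c b → (H.Adj p1 c ∨ H.Adj p2 c) →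
        (H.Adj p1 b ∨ H.Adj p2 b) → False := by
  set L := (X.filter (fun w => H.Adj p1 w)).erase p ∪ (X.filter (fun w => H.Adj p2 w)).erase p with hL
  have hLm : ∀ w, w ∈ L ↔ w ≠ p ∧ w ∈ X ∧ (H.Adj p1 w ∨ H.Adj p2 w) := by
    intro w
    simp only [hL, mem_union, mem_erase, mem_filter]
    tauto
  have hLc : L.card ≤ 4 := by
    have e1 := card_erase_add_one (show p ∈ X.filter (fun w => H.Adj p1 w) by
      simp [hp, pp1.symm])
    have e2 := card_erase_add_one (show p ∈ X.filter (fun w => H.Adj p2 w) by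
      simp [hp, pp2.symm])
    have h1 := hd p1 hp1 pp1.ne'
    have h2 := hd p2 hp2 pp2.ne'
    unfold dg at h1 h2
    have := card_union_le ((X.filter (fun w => H.Adj p1 w)).erase p)
      ((X.filter (fun w => H.Adj p2 w)).erase p)
    rw [← hL] at this
    omega
  have hpL : ∀ w ∈ L, w ≠ p1 ∧ w ≠ p2 := by
    intro w hw
    obtain ⟨h1, h2, h3⟩ := (hLm w).1 hw
    constructor
    · rintro rfl
      rcases h3 with h3 | h3
      · exact h3.ne rfl
      · exact htf p hp w h2 p2 hp2 pp1 h3.symm pp2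
    · rintro rfl
      rcases h3 with h3 | h3
      · exact htf p hp p1 hp1 w h2 pp1 h3 pp2
      · exact h3.ne rfl
  set B := X.filter (fun v => v ∉ L ∧ v ≠ p1 ∧ v ≠ p2 ∧
    ∃ c ∈ L, H.Adj v c ∧ ∃ b ∈ L, H.Adj c b) with hB
  have hBc : B.card ≤ 4 := by
    refine le_trans ?_ hLc
    have hB' : ∀ v ∈ B, ∃ c ∈ L, H.Adj v c ∧ ∃ b ∈ L, H.Adj c b := by
      intro v hv
      rw [hB, mem_filter] at hv
      exact hv.2.2.2.2
    choose! f hf1 hf2 hf3 using hB'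
    refine card_le_card_of_injOn f (fun v hv => hf1 v hv) ?_
    intro v hv u hu hvu
    by_contra hne
    have hv' := hv
    have hu' := hu
    simp only [mem_coe] at hv hu
    rw [mem_coe, hB, mem_filter] at hv' hu'
    obtain ⟨b, hb, hcb⟩ := hf3 v hv
    obtain ⟨c1, c2, c3⟩ := (hLm _).1 (hf1 v hv)
    have hb' := (hLm b).1 hb
    obtain ⟨b1, b2⟩ := hpL b hb
    have d3 := hd _ c2 c1
    have fu := hf2 u hu
    rw [← hvu] at fu
    have bv : v ≠ b := by rintro rfl; exact hv'.2.1 hb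
    have bu : u ≠ b := by rintro rfl; exact hu'.2.1 hb
    have fv := hf2 v hv
    rcases c3 with c3 | c3
    · have := dg_ge4 hp1 hb'.2.1 hv'.1 hu'.1 b1.symm hv'.2.2.1.symm bv.symm hu'.2.2.1 bu
        (Ne.symm hne) c3.symm hcb fv.symm fu.symm
      omega
    · have := dg_ge4 hp2 hb'.2.1 hv'.1 hu'.1 b2.symm hv'.2.2.2.1.symm bv.symm hu'.2.2.2.1 bu
        (Ne.symm hne) c3.symm hcb fv.symm fu.symm
      omega
  obtain ⟨v, hv, hvT⟩ : ∃ v ∈ X, v ∉ ({p, p1, p2} : Finset V) ∪ (L ∪ B) := by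
    by_contra hno
    push Not at hno
    have h1 := card_le_card (show X ⊆ _ from hno)
    have h2 := card_union_le ({p, p1, p2} : Finset V) (L ∪ B)
    have h3 := card_union_le L B
    have h4 : ({p, p1, p2} : Finset V).card ≤ 3 := card_le_three
    omega
  simp only [mem_union, mem_insert, mem_singleton, not_or] at hvT
  obtain ⟨⟨v1, v2, v3⟩, vL, vB⟩ := hvT
  have vL' := vL
  rw [hLm] at vL'
  refine ⟨v, hv, v1, v2, v3, fun h => vL' ⟨v1, hv, Or.inl h⟩, fun h => vL' ⟨v1, hv, Or.inr h⟩, ?_⟩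
  intro c hc b hb cp bp vc cb h1 h2
  apply vB
  rw [hB, mem_filter]
  exact ⟨hv, vL, v2, v3, c, (hLm c).2 ⟨cp, hc, h1⟩, vc, b, (hLm b).2 ⟨bp, hb, h2⟩, cb⟩

end FMember4

section FMember5
open scoped Classical
open Finset

variable {V : Type} [Fintype V]

set_option maxHeartbeats 1000000 in
lemma beta {H : SimpleGraph V} {X : Finset V} (hX : X.card = 13) (htf : TF H X) (hqf : QF H X)
    {p : V} (hp : p ∈ X) (dp : dg H X p = 2)
    (hd : ∀ x ∈ X, x ≠ p → dg H X x = 3) : InF 4 3 H X := by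
  obtain ⟨p1, p2, hp1, hp2, hp12, pp1, pp2, np⟩ := dg_two dp
  obtain ⟨v, hv, vp, vp1, vp2, np1v, np2v, hvb⟩ := beta_choose hX htf hp hp1 hp2 pp1 pp2 hd
  obtain ⟨x, y, z, hx, hy, hz, hxy, hxz, hyz, vx, vy, vz, hn⟩ := dg_three (hd v hv vp)
  have npv : ¬ H.Adj p v := fun h => by
    rcases np v hv h with h | h <;> contradiction
  have ne : ∀ w ∈ X, H.Adj v w → w ≠ p ∧ ¬ H.Adj p w := by
    intro w hwX hw
    refine ⟨by rintro rfl; exact npv hw.symm, fun h => ?_⟩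
    rcases np w hwX h with rfl | rfl
    · exact np1v hw.symm
    · exact np2v hw.symm
  obtain ⟨xp, npx⟩ := ne x hx vx
  obtain ⟨yp, npy⟩ := ne y hy vy
  obtain ⟨zp, npz⟩ := ne z hz vz
  -- the centres
  set C : Finset V := {p, x, y, z} with hCdef
  have hC : ∀ c ∈ C, c ∈ X ∧ (c = p ∨ (c ≠ p ∧ H.Adj v c ∧ dg H X c = 3)) := by
    intro c hc
    simp only [hCdef, mem_insert, mem_singleton] at hc
    rcases hc with rfl | rfl | rfl | rfl
    · exact ⟨hp, Or.inl rfl⟩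
    · exact ⟨hx, Or.inr ⟨xp, vx, hd _ hx xp⟩⟩
    · exact ⟨hy, Or.inr ⟨yp, vy, hd _ hy yp⟩⟩
    · exact ⟨hz, Or.inr ⟨zp, vz, hd _ hz zp⟩⟩
  -- two centres adjacent to `v` have no other common neighbour
  have two : ∀ c ∈ X, ∀ c' ∈ X, c ≠ c' → H.Adj v c → H.Adj v c' → ∀ w ∈ X, w ≠ v → H.Adj c w →
      H.Adj c' w → False := by
    intro c hc c' hc' hne h h' w hw hwv cw cw'
    exact hqf c hc c' hc' v hv w hw hne (Ne.symm hwv) h.symm cw h'.symm cw'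
  -- the mixed case
  have mix : ∀ c ∈ X, c ≠ p → H.Adj v c → ∀ w ∈ X, ∀ a ∈ X, ∀ b ∈ X, w ≠ a → b ≠ p → b ≠ v →
      H.Adj p w → H.Adj c w → H.Adj p a → H.Adj c b →
      (H.Adj a b ∨ ∃ c'' ∈ C, c'' ≠ p ∧ c'' ≠ c ∧ H.Adj c'' a ∧ H.Adj c'' b) → False := by
    intro c hc hcp vc w hw a ha b hb hwa hbp hbv pw cw pa cb h
    have hcw : H.Adj p1 c ∨ H.Adj p2 c := by
      rcases np w hw pw with rfl | rfl
      · exact Or.inl cw.symm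
      · exact Or.inr cw.symm
    rcases h with h | ⟨c'', hc'', h1, h2, h3, h4⟩
    · refine hvb c hc b hb hcp hbp vc cb hcw ?_
      rcases np a ha pa with rfl | rfl
      · exact Or.inl h
      · exact Or.inr h
    · obtain ⟨k1, k2⟩ := hC c'' hc''
      rcases k2 with k2 | k2
      · exact h1 k2
      · exact two c'' k1 c hc h2 k2.2.1 vc b hb hbv h4 cb
  -- generic transfer
  have gen : ∀ (J : SimpleGraph V) (X' C' : Finset V), C' ⊆ C → X' ⊆ X → p ∉ X' →
      (∀ c ∈ C', c ∉ X') → ((∃ c ∈ C', c ≠ p) → v ∉ X') →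
      (∀ a ∈ X', ∀ b ∈ X', J.Adj a b → H.Adj a b ∨ ∃ c ∈ C', H.Adj c a ∧ H.Adj c b) → TF J X' := by
    intro J X' C' hC' hsub hpX hcX hvX hJ
    apply tf_of (H := H) (C := C')
    · intro a ha b hb c hc; exact htf a (hsub ha) b (hsub hb) c (hsub hc)
    · exact hJ
    · intro c hc a ha b hb w hw hab ca cb wa wb
      exact hqf c (hC c (hC' hc)).1 w (hsub hw) a (hsub ha) b (hsub hb)
        (by rintro rfl; exact hcX _ hc hw) hab ca cb wa wb
    · intro c hc a ha b hb w hw hab haw hbw ca cb cw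
      obtain ⟨h1, h2 | ⟨h2, h3, h4⟩⟩ := hC c (hC' hc)
      · subst h2
        have := dg_ge3 (hsub ha) (hsub hb) (hsub hw) hab haw hbw ca cb cw
        omega
      · have hvX := hvX ⟨c, hc, h2⟩
        have nv : ∀ u ∈ X', v ≠ u := by rintro u hu rfl; exact hvX hu
        have := dg_ge4 (hsub ha) (hsub hb) (hsub hw) hv hab haw hbw (nv a ha) (nv b hb) (nv w hw)
          ca cb cw h3.symm
        omega
    · intro c hc c' hc' hne w hw a ha b hb wa wb ab cw cw' ca cb hh
      have hh' : H.Adj a b ∨ ∃ c'' ∈ C, c'' ≠ c ∧ c'' ≠ c' ∧ H.Adj c'' a ∧ H.Adj c'' b := by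
        rcases hh with hh | ⟨c'', k, k'⟩
        · exact Or.inl hh
        · exact Or.inr ⟨c'', hC' k, k'⟩
      have nvX : v ∉ X' := by
        by_cases e : c = p
        · exact hvX ⟨c', hc', fun h => hne (e.trans h.symm)⟩
        · exact hvX ⟨c, hc, e⟩
      have nv : ∀ u ∈ X', u ≠ v := by rintro u hu rfl; exact nvX hu
      have npX : ∀ u ∈ X', u ≠ p := by rintro u hu rfl; exact hpX hu
      obtain ⟨h1, h2⟩ := hC c (hC' hc)
      obtain ⟨h1', h2'⟩ := hC c' (hC' hc')
      rcases h2 with h2 | ⟨h2, h3, h4⟩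
      · rcases h2' with h2' | ⟨h2', h3', h4'⟩
        · exact hne (h2.trans h2'.symm)
        · subst h2
          exact mix c' h1' h2' h3' w (hsub hw) a (hsub ha) b (hsub hb) wa (npX b hb) (nv b hb)
            cw cw' ca cb hh'
      · rcases h2' with h2' | ⟨h2', h3', h4'⟩
        · subst h2'
          refine mix c h1 h2 h3 w (hsub hw) b (hsub hb) a (hsub ha) wb (npX a ha) (nv a ha)
            cw' cw cb ca ?_
          rcases hh' with hh' | ⟨c'', k1, k2, k3, k4, k5⟩
          · exact Or.inl hh'.symm
          · exact Or.inr ⟨c'', k1, k3, k2, k5, k4⟩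
        · exact two c h1 c' h1' hne h3 h3' w (hsub hw) (nv w hw) cw cw'
  -- smooth `p`
  obtain ⟨H1, f1, g1, k1⟩ := smooth_tf hp dp (fun a ha b hb h1 h2 h3 => htf p hp a ha b hb h1 h3 h2)
  have m1 : ∀ w, w ∈ X.erase p ↔ w ≠ p ∧ w ∈ X := fun w => mem_erase
  have tf1 : TF H1 (X.erase p) := by
    refine gen H1 (X.erase p) {p} ?_ (erase_subset _ _) (by simp) (by simp) ?_ ?_
    · simp [hCdef]
    · rintro ⟨c, hc, hcp⟩; exact absurd (mem_singleton.1 hc) hcp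
    · intro a _ b _ h
      rcases k1 a b h with h | h
      · exact Or.inl h
      · exact Or.inr ⟨p, by simp, h⟩
  have up : ∀ a b, ¬ H.Adj p a → H1.Adj a b → H.Adj a b := by
    intro a b hna h
    rcases k1 a b h with h | h
    · exact h
    · exact absurd h.1 hna
  have down : ∀ a ∈ X, a ≠ p → ¬ H.Adj p a → ∀ b ∈ X, H.Adj a b → H1.Adj a b := by
    intro a ha hap hna b hb hab
    have hbp : b ≠ p := by rintro rfl; exact hna hab.symm
    refine adj_of_dg (X := X.erase p) ((X.erase p).filter (fun w => H.Adj a w)) ?_ ?_ b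
      (by simp [hb, hbp, hab])
    · intro w hw h
      exact mem_filter.2 ⟨hw, up a w hna h⟩
    · rw [g1 a ha hap, ← dg_erase_not (v := p) (fun h => hna h.symm)]
      exact le_of_eq rfl
  have d1 : ∀ a ∈ X, a ≠ p → dg H1 (X.erase p) a = 3 := by
    intro a ha hap; rw [g1 a ha hap, hd a ha hap]
  have hw : ∃ w ∈ X.erase p, H1.Adj y w ∧ ¬ H1.Adj z w := by
    obtain ⟨a, b, ha, hb, hab, hav, hbv, ya, yb, -⟩ := dg_three_of (hd y hy yp) hv vy.symm
    have hap : a ≠ p := by rintro rfl; exact npy ya.symm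
    refine ⟨a, mem_erase.2 ⟨hap, ha⟩, down y hy yp npy a ha ya, fun h => ?_⟩
    exact two y hy z hz hyz vy vz a ha hav ya (up z a npz h)
  obtain ⟨H2, X2, hc2, hm2, hf2, hdx2, hdw2, k2⟩ := op_tf tf1 ((m1 v).2 ⟨vp, hv⟩)
    ((m1 x).2 ⟨xp, hx⟩) ((m1 y).2 ⟨yp, hy⟩) ((m1 z).2 ⟨zp, hz⟩) hxy hxz hyz
    (down v hv vp npv x hx vx) (down v hv vp npv y hy vy) (down v hv vp npv z hz vz)
    (fun w hw h => hn w ((m1 w).1 hw).2 (up v w npv h)) (d1 x hx xp) (d1 y hy yp) (d1 z hz zp) hw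
  have m2 : ∀ w, w ∈ X2 ↔ (w ≠ p ∧ w ∈ X) ∧ w ≠ v ∧ w ≠ y ∧ w ≠ z := by
    intro w; rw [hm2, m1]
  have hx2 : x ∈ X2 := (m2 x).2 ⟨⟨xp, hx⟩, vx.ne', hxy, hxz⟩
  have j2 : ∀ a b, H2.Adj a b → H.Adj a b ∨ (H.Adj p a ∧ H.Adj p b) ∨ (H.Adj y a ∧ H.Adj y b) ∨
      (H.Adj z a ∧ H.Adj z b) := by
    intro a b h
    rcases k2 a b h with h | h | h
    · rcases k1 a b h with h | h
      · exact Or.inl h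
      · exact Or.inr (Or.inl h)
    · exact Or.inr (Or.inr (Or.inl ⟨up y a npy h.1, up y b npy h.2⟩))
    · exact Or.inr (Or.inr (Or.inr ⟨up z a npz h.1, up z b npz h.2⟩))
  have tf2 : TF H2 X2 := by
    refine gen H2 X2 {p, y, z} ?_ ?_ ?_ ?_ ?_ ?_
    · intro c; simp only [hCdef, mem_insert, mem_singleton]
      rintro (h | h | h) <;> simp [h]
    · intro w hw; exact ((m2 w).1 hw).1.2
    · intro h; exact ((m2 p).1 h).1.1 rfl
    · intro c hc h
      simp only [mem_insert, mem_singleton] at hc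
      obtain ⟨⟨h1, -⟩, -, h2, h3⟩ := (m2 c).1 h
      rcases hc with hc | hc | hc <;> contradiction
    · intro _ h; exact ((m2 v).1 h).2.1 rfl
    · intro a _ b _ h
      rcases j2 a b h with h | h | h | h
      · exact Or.inl h
      · exact Or.inr ⟨p, by simp, h⟩
      · exact Or.inr ⟨y, by simp, h⟩
      · exact Or.inr ⟨z, by simp, h⟩
  -- smooth `x`
  obtain ⟨H3, f3, g3, k3⟩ := smooth_tf hx2 hdx2
    (fun a ha b hb h1 h2 h3 => tf2 x hx2 a ha b hb h1 h3 h2)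
  have upx : ∀ a, H2.Adj x a → H.Adj x a := by
    intro a h
    rcases j2 x a h with h | h | h | h
    · exact h
    · exact absurd h.1 npx
    · exact (htf v hv y hy x hx vy h.1 vx).elim
    · exact (htf v hv z hz x hx vz h.1 vx).elim
  have m3 : ∀ w, w ∈ X2.erase x ↔ w ≠ x ∧ w ∈ X2 := fun w => mem_erase
  have tf3 : TF H3 (X2.erase x) := by
    refine gen H3 (X2.erase x) C (Subset.refl _) ?_ ?_ ?_ ?_ ?_
    · intro w hw; exact ((m2 w).1 ((m3 w).1 hw).2).1.2
    · intro h; exact ((m2 p).1 ((m3 p).1 h).2).1.1 rfl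
    · intro c hc h
      simp only [hCdef, mem_insert, mem_singleton] at hc
      obtain ⟨h0, h⟩ := (m3 c).1 h
      obtain ⟨⟨h1, -⟩, -, h2, h3⟩ := (m2 c).1 h
      rcases hc with hc | hc | hc | hc <;> contradiction
    · intro _ h; exact ((m2 v).1 ((m3 v).1 h).2).2.1 rfl
    · intro a _ b _ h
      rcases k3 a b h with h | h
      · rcases j2 a b h with h | h | h | h
        · exact Or.inl h
        · exact Or.inr ⟨p, by simp [hCdef], h⟩
        · exact Or.inr ⟨y, by simp [hCdef], h⟩
        · exact Or.inr ⟨z, by simp [hCdef], h⟩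
      · exact Or.inr ⟨x, by simp [hCdef], upx a h.1, upx b h.2⟩
  have e1 := card_erase_add_one hp
  have e2 := card_erase_add_one hx2
  refine f1 3 3 (hf2 3 2 (f3 2 2 (jlem (by omega) tf3 ?_)))
  intro w hw
  obtain ⟨h0, h⟩ := (m3 w).1 hw
  obtain ⟨⟨h1, h2⟩, -⟩ := (m2 w).1 h
  rw [g3 w h h0, hdw2 w h h0, d1 w h2 h1]

end FMember5

section Final1
open scoped Classical
open Finset

variable {V : Type} [Fintype V]

lemma short_cycle {G : SimpleGraph V} {A : Finset V} (h : ¬ (TF G A ∧ QF G A)) :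
    ∃ (u : V) (c : G.Walk u u), c.IsCycle ∧ c.length < 5 ∧ ∀ x ∈ c.support, x ∈ A := by
  rw [not_and_or] at h
  rcases h with h | h
  · unfold TF at h
    push Not at h
    obtain ⟨a, ha, b, hb, c, hc, h1, h2, h3⟩ := h
    refine ⟨a, .cons h1 (.cons h2 (.cons h3.1.symm .nil)), ?_, by simp, ?_⟩
    · have := h1.ne
      have := h2.ne
      have := h3.1.ne
      simp only [Walk.cons_isCycle_iff, Walk.cons_isPath_iff, Walk.isPath_iff_nil, Walk.nil_nil,
        Walk.support_cons, Walk.support_nil, Walk.edges_cons, Walk.edges_nil, List.mem_cons,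
        List.not_mem_nil, Sym2.eq_iff]
      grind
    · simp [ha, hb, hc]
  · unfold QF at h
    push Not at h
    obtain ⟨a, ha, c, hc, b, hb, d, hd, hac, hbd, h1, h2, h3, h4⟩ := h
    refine ⟨a, .cons h1 (.cons h3.symm (.cons h4.1 (.cons h2.symm .nil))), ?_, by simp, ?_⟩
    · have := h1.ne
      have := h2.ne
      have := h3.ne
      have := h4.1.ne
      simp [Walk.cons_isCycle_iff, *]
      grind
    · simp [ha, hb, hc, hd]

lemma girth_ge {G : SimpleGraph V} {A : Finset V} (ht : TF G A) (hq : QF G A) (hA : A.Nonempty)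
    (hd : ∀ a ∈ A, 2 ≤ dg G A a) : 5 ≤ (G.induce (A : Set V)).girth := by
  set K := G.induce (A : Set V) with hK
  have hadj : ∀ a b, K.Adj a b → G.Adj a.1 b.1 := fun a b h => h
  have hna : ¬ K.IsAcyclic := by
    intro hac
    have key : ∀ k : ℕ, ∃ (u v : (A : Set V)) (p : K.Walk u v), p.IsPath ∧ p.length = k := by
      intro k
      induction k with
      | zero =>
        obtain ⟨a, ha⟩ := hA
        exact ⟨⟨a, ha⟩, ⟨a, ha⟩, .nil, by simp, rfl⟩
      | succ k ih =>
        obtain ⟨u, v, p, hp, hl⟩ := ih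
        have h2 := hd v.1 v.2
        unfold dg at h2
        obtain ⟨w, hw, hwp⟩ := exists_mem_ne (show 1 < _ from h2) p.penultimate.1
        rw [mem_filter] at hw
        have hvw : K.Adj v ⟨w, hw.1⟩ := hw.2
        refine ⟨u, ⟨w, hw.1⟩, p.concat hvw, hp.concat ?_ hvw, by simp [hl]⟩
        intro hin
        exact hwp (congrArg Subtype.val (hac.eq_penultimate_of_adj_end hp hvw hin))
    obtain ⟨u, v, p, hp, hl⟩ := key (Fintype.card (A : Set V))
    have := hp.length_lt
    omega
  have h5 : (5 : ℕ∞) ≤ K.egirth := by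
    rw [SimpleGraph.le_egirth]
    intro a w hw
    by_contra hlt
    have hlt : w.length < 5 := by
      rw [not_le] at hlt
      exact_mod_cast hlt
    match w, hw, hlt with
    | .nil, hw, _ => simp at hw
    | .cons h1 .nil, hw, _ => exact absurd h1 (by simp)
    | .cons h1 (.cons h2 .nil), hw, _ => simp [Walk.cons_isCycle_iff] at hw
    | .cons (v := b) h1 (.cons (v := c) h2 (.cons h3 .nil)), hw, _ =>
      exact ht _ a.2 _ b.2 _ c.2 (hadj _ _ h1) (hadj _ _ h2) (hadj _ _ h3).symm
    | .cons (v := b) h1 (.cons (v := c) h2 (.cons (v := d) h3 (.cons h4 .nil))), hw, _ =>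
      simp only [Walk.cons_isCycle_iff, Walk.cons_isPath_iff, Walk.isPath_iff_nil, Walk.nil_nil,
        Walk.support_cons, Walk.support_nil, Walk.edges_cons, Walk.edges_nil, List.mem_cons,
        List.not_mem_nil] at hw
      refine hq _ a.2 _ c.2 _ b.2 _ d.2 ?_ ?_ (hadj _ _ h1) (hadj _ _ h4).symm (hadj _ _ h2).symm
        (hadj _ _ h3)
      · intro h; have := Subtype.ext h; grind
      · intro h; have := Subtype.ext h; grind
    | .cons h1 (.cons h2 (.cons h3 (.cons h4 (.cons h5 p)))), hw, hlt =>
      simp only [Walk.length_cons] at hlt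
      omega
  have hne : K.egirth ≠ ⊤ := fun h => hna (SimpleGraph.egirth_eq_top.1 h)
  unfold SimpleGraph.girth
  obtain ⟨n, hn⟩ := ENat.ne_top_iff_exists.1 hne
  rw [← hn] at h5 ⊢
  simpa using h5

lemma moore {G : SimpleGraph V} {A : Finset V} (ht : TF G A) (hq : QF G A) :
    10 * (ed G A).card ≤ A.card * A.card + 5 * A.card := by
  have h1 : ∀ a ∈ A, ∑ v ∈ A.filter (fun v => G.Adj a v), dg G A v + 1 ≤ A.card := by
    intro a ha
    set N := A.filter (fun v => G.Adj a v) with hN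
    set M := fun v => (A.filter (fun w => G.Adj v w)).erase a with hM
    have e1 : ∀ v ∈ N, dg G A v = (M v).card + 1 := by
      intro v hv
      rw [hN, mem_filter] at hv
      rw [hM]
      simp only
      rw [card_erase_add_one (mem_filter.2 ⟨ha, hv.2.symm⟩)]
      rfl
    have e2 : (N.biUnion M).card = ∑ v ∈ N, (M v).card := by
      apply card_biUnion
      intro v hv u hu hne
      show Disjoint (M v) (M u)
      rw [Finset.disjoint_left]
      intro w hw hw'
      simp only [hM, mem_erase, mem_filter] at hw hw'
      rw [hN] at hv hu
      simp only [coe_filter, Set.mem_setOf_eq, mem_filter] at hv hu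
      exact hq v hv.1 u hu.1 a ha w hw.2.1 hne (Ne.symm hw.1) hv.2.symm hw.2.2 hu.2.symm hw'.2.2
    have e3 : N.biUnion M ⊆ (A.erase a) \ N := by
      intro w hw
      rw [mem_biUnion] at hw
      obtain ⟨v, hv, hw⟩ := hw
      simp only [hM, mem_erase, mem_filter] at hw
      rw [hN, mem_filter] at hv
      simp only [mem_sdiff, mem_erase, hN, mem_filter, not_and]
      exact ⟨⟨hw.1, hw.2.1⟩, fun _ h => ht a ha v hv.1 w hw.2.1 hv.2 hw.2.2 h⟩
    have e4 := card_le_card e3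
    have e5 : N ⊆ A.erase a := by
      intro w hw
      rw [hN, mem_filter] at hw
      exact mem_erase.2 ⟨hw.2.ne', hw.1⟩
    have e6 := card_sdiff_add_card_eq_card e5
    have e7 := card_erase_add_one ha
    rw [sum_congr rfl e1, sum_add_distrib, ← e2]
    simp only [sum_const, smul_eq_mul, mul_one]
    omega
  have h2 : ∑ a ∈ A, ∑ v ∈ A.filter (fun v => G.Adj a v), dg G A v = ∑ v ∈ A, dg G A v * dg G A v := by
    simp_rw [sum_filter]
    rw [sum_comm]
    refine sum_congr rfl fun v _ => ?_
    rw [← sum_filter, sum_const, smul_eq_mul]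
    congr 1
    unfold dg
    congr 1
    ext w
    simp [SimpleGraph.adj_comm]
  have h3 := sum_le_sum h1
  rw [sum_add_distrib, h2] at h3
  simp only [sum_const, smul_eq_mul, mul_one] at h3
  have h4 := sum_dg G A
  have h5 : ∑ v ∈ A, 5 * dg G A v ≤ ∑ v ∈ A, (dg G A v * dg G A v + 6) := by
    refine sum_le_sum fun v _ => ?_
    rcases Nat.lt_or_ge (dg G A v) 4 with h | h
    · interval_cases (dg G A v) <;> simp
    · nlinarith
  rw [← mul_sum, h4, sum_add_distrib] at h5
  simp only [sum_const, smul_eq_mul] at h5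
  omega

end Final1

section Final2
open scoped Classical
open Finset

variable {V : Type} [Fintype V]

lemma dg_le_ncard (G : SimpleGraph V) (A : Finset V) (a : V) : dg G A a ≤ (G.neighborSet a).ncard := by
  unfold dg
  rw [← Set.ncard_coe_finset]
  apply Set.ncard_le_ncard
  · intro w hw
    rw [mem_coe, mem_filter] at hw
    exact hw.2
  · exact Set.toFinite _

lemma ed_univ (G : SimpleGraph V) : (ed G univ).card = G.edgeSet.ncard := by
  rw [← Set.ncard_coe_finset]
  congr 1
  ext e
  simp [ed]

lemma ed_le_three {G : SimpleGraph V} (hsub : ∀ v : V, (G.neighborSet v).ncard ≤ 3) (A : Finset V) :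
    2 * (ed G A).card ≤ 3 * A.card := by
  rw [← sum_dg]
  have : ∑ x ∈ A, dg G A x ≤ ∑ x ∈ A, 3 := sum_le_sum fun x _ => (dg_le_ncard G A x).trans (hsub x)
  simp only [sum_const, smul_eq_mul] at this
  omega

lemma ed_le_choose (G : SimpleGraph V) (A : Finset V) :
    2 * (ed G A).card + A.card ≤ A.card * A.card := by
  rw [← sum_dg]
  have : ∑ x ∈ A, (dg G A x + 1) ≤ ∑ x ∈ A, A.card := by
    refine sum_le_sum fun x hx => ?_
    have h1 : A.filter (fun y => G.Adj x y) ⊆ A.erase x := by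
      intro w hw
      rw [mem_filter] at hw
      exact mem_erase.2 ⟨hw.2.ne', hw.1⟩
    have h2 := card_le_card h1
    have h3 := card_erase_add_one hx
    unfold dg
    omega
  rw [sum_add_distrib] at this
  simpa using this

lemma ed_le_boundary {G : SimpleGraph V} (hconn : G.Connected)
    (hsub : ∀ v : V, (G.neighborSet v).ncard ≤ 3) {A : Finset V} (hA : A.Nonempty)
    {b : V} (hb : b ∉ A) : 2 * (ed G A).card + 1 ≤ 3 * A.card := by
  obtain ⟨a, ha⟩ := hA
  obtain ⟨p⟩ := hconn.preconnected a b
  obtain ⟨d, -, h1, h2⟩ := p.exists_boundary_dart (A : Set V) ha hb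
  have hadj := d.adj
  set x := d.toProd.1
  set y := d.toProd.2
  have h3 : dg G A x < 3 := by
    have e1 := dg_le_ncard G (insert y A) x
    have e2 : dg G (insert y A) x = dg G A x + 1 := by
      have := dg_erase_adj (H := G) (X := insert y A) (mem_insert_self y A) hadj
      rw [erase_insert h2] at this
      exact this.symm
    have := hsub x
    omega
  rw [← sum_dg]
  have : ∑ z ∈ A, dg G A z < ∑ z ∈ A, 3 :=
    sum_lt_sum (fun z _ => (dg_le_ncard G A z).trans (hsub z)) ⟨x, h1, h3⟩
  simp only [sum_const, smul_eq_mul] at this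
  omega

noncomputable def ee (G : SimpleGraph V) (A : Finset V) : ℤ :=
  3 * (ed G A).card - 5 * A.card + 3 + 7 * (bet G A % 2)

lemma ee_le_eight {G : SimpleGraph V} (hsub : ∀ v : V, (G.neighborSet v).ncard ≤ 3) (A : Finset V)
    (hA : A.Nonempty) : ee G A ≤ 8 := by
  have h1 := ed_le_three hsub A
  have h2 := ed_le_choose G A
  have h3 := hA.card_pos
  unfold ee bet
  generalize (ed G A).card = m at *
  generalize A.card = n at *
  rcases Nat.lt_or_ge n 4 with h | h
  · interval_cases n <;> omega
  · omega

lemma dg_ge_two {G : SimpleGraph V} {Q : Finset (Finset V)} (hQ : IsOpt G Q univ) {A : Finset V}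
    (hA : A ∈ Q) (h1 : 1 < A.card) (hodd : bet G A % 2 = 1) {v : V} (hv : v ∈ A) : 2 ≤ dg G A v := by
  by_contra hlt
  have hne : (A.erase v).Nonempty := by
    rw [← card_pos]
    have := card_erase_add_one hv
    omega
  have hd : Disjoint {v} (A.erase v) := by simp
  have hu : ({v} : Finset V) ∪ A.erase v = A := by
    rw [← insert_eq, insert_erase hv]
  have hP := ((isPart_singleton (singleton_nonempty v)).union (isPart_singleton hne) hd)
  rw [hu] at hP
  have hW := hQ.replace1 hA hP.1
  have hc : (({{v}} : Finset (Finset V)) ∪ {A.erase v}).card = 2 := by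
    rw [card_union_of_disjoint hP.2]; simp
  have h2 := sum_lt_of_Wt (by omega) hW
  rw [sum_union hP.2, sum_singleton, sum_singleton, wt_singleton] at h2
  have e1 := ed_erase G A v hv
  have e2 := card_erase_add_one hv
  unfold wt bet at h2
  unfold bet at hodd
  omega

lemma ee_le_zero {G : SimpleGraph V} (hconn : G.Connected)
    (hsub : ∀ v : V, (G.neighborSet v).ncard ≤ 3)
    (hF : ∀ (W : Type) (H : SimpleGraph W), InFamilyF H → ¬ ContainsInducedSubdivision G H)
    {Q : Finset (Finset V)} (hQ : IsOpt G Q univ) {A : Finset V} (hA : A ∈ Q)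
    {b : V} (hb : b ∉ A) (ht : TF G A) (hq : QF G A) : ee G A ≤ 0 := by
  have hne := hQ.1.nonempty hA
  have h1 := ed_le_boundary hconn hsub hne hb
  have h2 := ed_le_choose G A
  have h3 := hne.card_pos
  have h4 := moore ht hq
  by_contra hpos
  have hodd : bet G A % 2 = 1 ∧ 1 < A.card ∧ ((A.card = 10 ∧ (ed G A).card = 14) ∨
      (A.card = 13 ∧ (ed G A).card = 19)) := by
    unfold ee bet at hpos
    unfold bet
    generalize (ed G A).card = m at *
    generalize A.card = n at *
    rcases Nat.lt_or_ge n 17 with h | h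
    · interval_cases n <;> omega
    · omega
  obtain ⟨hodd, hn1, hnm⟩ := hodd
  have hd2 : ∀ a ∈ A, 2 ≤ dg G A a := fun a ha => dg_ge_two hQ hA hn1 hodd ha
  have hd3 : ∀ a ∈ A, dg G A a ≤ 3 := fun a _ => (dg_le_ncard G A a).trans (hsub a)
  set D := A.filter (fun a => dg G A a = 2) with hD
  have hDc : D.card + 2 * (ed G A).card = 3 * A.card := by
    rw [← sum_dg, hD, card_filter, ← sum_add_distrib, mul_comm, ← smul_eq_mul, ← sum_const]
    refine sum_congr rfl fun a ha => ?_
    have := hd2 a ha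
    have := hd3 a ha
    split_ifs <;> omega
  have hDm : ∀ a, a ∈ D ↔ a ∈ A ∧ dg G A a = 2 := fun a => by rw [hD, mem_filter]
  have hrest : ∀ a ∈ A, a ∉ D → dg G A a = 3 := by
    intro a ha h
    have := hd2 a ha
    have := hd3 a ha
    rw [hDm] at h
    have : dg G A a ≠ 2 := fun h' => h ⟨ha, h'⟩
    omega
  have hin : IsInF 4 2 (G.induce (A : Set V)) ∨ IsInF 4 3 (G.induce (A : Set V)) := by
    rcases hnm with ⟨hn, hm⟩ | ⟨hn, hm⟩
    · left
      obtain ⟨p, q, hpq, hDpq⟩ := card_eq_two.1 (show D.card = 2 by omega)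
      have hp := (hDm p).1 (by simp [hDpq])
      have hq' := (hDm q).1 (by simp [hDpq])
      refine alpha hn ht hq hp.1 hq'.1 hpq hp.2 hq'.2 ?_
      intro x hx h1 h2
      exact hrest x hx (by simp [hDpq, h1, h2])
    · right
      obtain ⟨p, hDp⟩ := card_eq_one.1 (show D.card = 1 by omega)
      have hp := (hDm p).1 (by simp [hDp])
      refine beta hn ht hq hp.1 hp.2 ?_
      intro x hx h1
      exact hrest x hx (by simp [hDp, h1])
  refine hF _ (G.induce (A : Set V)) (Or.inl ⟨hin, girth_ge ht hq hne hd2⟩) ?_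
  exact ⟨(A : Set V), _, _, IsSubdivisionOf.refl _, ⟨SimpleGraph.Iso.refl⟩⟩

/-- Counting edges between the parts. -/
lemma cross_count {G : SimpleGraph V} (hconn : G.Connected) {Q : Finset (Finset V)}
    (hQ : IsPart Q univ) :
    ∑ A ∈ Q, (ed G A).card + Q.card ≤ (ed G univ).card + 1 := by
  have hex : ∀ x : V, ∃ A : {A // A ∈ Q}, x ∈ A.1 := by
    intro x
    have hx : x ∈ Q.biUnion id := by rw [hQ.2.2]; simp
    rw [mem_biUnion] at hx
    obtain ⟨A, hA, hx⟩ := hx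
    exact ⟨⟨A, hA⟩, hx⟩
  choose l hl using hex
  have huniq : ∀ (x : V) (A : {A // A ∈ Q}), x ∈ A.1 → l x = A := by
    intro x A hx
    by_contra hne
    exact Finset.disjoint_left.1 (hQ.2.1 _ (l x).2 _ A.2 (fun h => hne (Subtype.ext h))) (hl x) hx
  have hs := ed_split G l univ univ (fun y _ => mem_univ _)
  have hf : ∀ A : {A // A ∈ Q}, univ.filter (fun y => l y = A) = A.1 := by
    intro A
    ext x
    simp only [mem_filter, mem_univ, true_and]
    exact ⟨fun h => h ▸ hl x, huniq x A⟩
  simp_rw [hf] at hs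
  have hsum : ∑ A : {A // A ∈ Q}, (ed G A.1).card = ∑ A ∈ Q, (ed G A).card :=
    Finset.sum_coe_sort Q (fun A => (ed G A).card)
  rw [hsum] at hs
  let K : SimpleGraph {A // A ∈ Q} :=
    SimpleGraph.fromRel (fun A B => ∃ a b, G.Adj a b ∧ l a = A ∧ l b = B)
  have hreach : ∀ x y : V, G.Reachable x y → K.Reachable (l x) (l y) := by
    rintro x y ⟨p⟩
    induction p with
    | nil => exact SimpleGraph.Reachable.refl _
    | cons h p ih =>
      rename_i u v w
      by_cases e : l u = l v
      · rw [e]; exact ih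
      · refine SimpleGraph.Reachable.trans (SimpleGraph.Adj.reachable ?_) ih
        rw [SimpleGraph.fromRel_adj]
        exact ⟨e, Or.inl ⟨u, v, h, rfl, rfl⟩⟩
  have hK : K.Connected := by
    haveI : Nonempty {A // A ∈ Q} := ⟨l hconn.nonempty.some⟩
    refine SimpleGraph.Connected.mk ?_
    intro A B
    obtain ⟨a, ha⟩ := hQ.nonempty A.2
    obtain ⟨b, hb⟩ := hQ.nonempty B.2
    have := hreach a b (hconn.preconnected a b)
    rwa [huniq a A ha, huniq b B hb] at this
  have hc := hK.card_vert_le_card_edgeSet_add_one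
  have hQc : Nat.card {A // A ∈ Q} = Q.card := by simp
  have hEc : Nat.card K.edgeSet ≤ (cr G l univ univ).card := by
    have hsub : K.edgeSet ⊆ ((cr G l univ univ).image (Sym2.map l) : Finset _) := by
      intro e
      induction e using Sym2.ind with
      | _ A B =>
        intro h
        rw [SimpleGraph.mem_edgeSet, SimpleGraph.fromRel_adj] at h
        obtain ⟨hne, ⟨a, b, hab, rfl, rfl⟩ | ⟨a, b, hab, rfl, rfl⟩⟩ := h
        · rw [mem_coe, mem_image]
          exact ⟨s(a, b), mem_cr.2 ⟨⟨hab, by simp, by simp⟩, ⟨by simp, by simp⟩, hne⟩, rfl⟩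
        · rw [mem_coe, mem_image]
          exact ⟨s(b, a), mem_cr.2 ⟨⟨hab.symm, by simp, by simp⟩, ⟨by simp, by simp⟩, hne⟩, rfl⟩
    have h1 := Set.ncard_le_ncard hsub (Set.toFinite _)
    rw [Set.ncard_coe_finset] at h1
    exact h1.trans card_image_le
  omega

lemma main_bound {G : SimpleGraph V} (hconn : G.Connected)
    (hsub : ∀ v : V, (G.neighborSet v).ncard ≤ 3) (hcyc : ¬ HasTwoDisjointShortCycles G)
    (hF : ∀ (W : Type) (H : SimpleGraph W), InFamilyF H → ¬ ContainsInducedSubdivision G H) :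
    (14 * phi G : ℤ) ≤ 4 * (ed G univ).card - 2 * Fintype.card V + 12 := by
  obtain ⟨Q, hQ⟩ := exists_opt G univ
  have hphi := phi_le_opt G Q hQ hconn.nonempty
  have hcr := cross_count hconn hQ.1
  have hn : ∑ A ∈ Q, A.card = Fintype.card V := by
    rw [← card_univ, ← hQ.1.2.2, card_biUnion]
    · rfl
    · intro A hA B hB hne; exact hQ.1.2.1 A hA B hB hne
  have hee : ∑ A ∈ Q, ee G A ≤ 8 := by
    by_cases hs : ∃ A ∈ Q, ¬ (TF G A ∧ QF G A) ∨ A = univ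
    · obtain ⟨A, hA, hs⟩ := hs
      rw [← add_sum_erase Q _ hA]
      have h8 := ee_le_eight hsub A (hQ.1.nonempty hA)
      have h0 : ∑ B ∈ Q.erase A, ee G B ≤ 0 := by
        refine sum_nonpos fun B hB => ?_
        rw [mem_erase] at hB
        have hdis := hQ.1.2.1 B hB.2 A hA hB.1
        obtain ⟨a, ha⟩ := hQ.1.nonempty hA
        have haB : a ∉ B := fun h => Finset.disjoint_left.1 hdis h ha
        have hg : TF G B ∧ QF G B := by
          by_contra hB'
          rcases hs with hs | hs
          · obtain ⟨u, c, h1, h2, h3⟩ := short_cycle hs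
            obtain ⟨u', c', h1', h2', h3'⟩ := short_cycle hB'
            exact hcyc ⟨u, u', c, c', h1, h1', h2, h2', fun x hx hx' =>
              Finset.disjoint_left.1 hdis (h3' x hx') (h3 x hx)⟩
          · obtain ⟨b, hb⟩ := hQ.1.nonempty hB.2
            exact Finset.disjoint_left.1 hdis hb (by simp [hs])
        exact ee_le_zero hconn hsub hF hQ hB.2 haB hg.1 hg.2
      omega
    · push Not at hs
      have h0 : ∑ B ∈ Q, ee G B ≤ 0 := by
        refine sum_nonpos fun B hB => ?_
        obtain ⟨⟨h1, h2⟩, h3⟩ := hs B hB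
        obtain ⟨b, hb⟩ : ∃ b, b ∉ B := by
          by_contra hno
          push Not at hno
          exact h3 (eq_univ_iff_forall.2 hno)
        exact ee_le_zero hconn hsub hF hQ hB hb h1 h2
      omega
  have hid : ∑ A ∈ Q, (7 * wt G A) = ∑ A ∈ Q, (ee G A + 4 * ((ed G A).card : ℤ) - 2 * (A.card : ℤ) + 4) := by
    refine sum_congr rfl fun A _ => ?_
    unfold ee wt bet
    ring
  rw [← mul_sum, sum_add_distrib, sum_sub_distrib, sum_add_distrib, ← mul_sum, ← mul_sum] at hid
  simp only [sum_const, smul_eq_mul, nsmul_eq_mul] at hid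
  have hn' : ∑ A ∈ Q, (A.card : ℤ) = Fintype.card V := by exact_mod_cast hn
  have hcr' : ∑ A ∈ Q, ((ed G A).card : ℤ) + Q.card ≤ (ed G univ).card + 1 := by exact_mod_cast hcr
  rw [hn'] at hid
  linarith

end Final2

/-- If `G` is a finite connected subcubic simple graph on `n` vertices and `m`
edges with no two vertex-disjoint cycles each of length less than five and no induced
subdivision of any member of `𝓕`, then `φ(G) ≤ (2m − n + 6)/7`. -/
theorem statement_12 {V : Type} [Fintype V] (G : SimpleGraph V)
    (hconn : G.Connected)
    (hsub : ∀ v : V, (G.neighborSet v).ncard ≤ 3)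
    (hcyc : ¬ HasTwoDisjointShortCycles G)
    (hF : ∀ (W : Type) (H : SimpleGraph W), InFamilyF H → ¬ ContainsInducedSubdivision G H) :
    (phi G : ℝ) ≤ (2 * (G.edgeSet.ncard : ℝ) - (Nat.card V : ℝ) + 6) / 7 := by
  have h := main_bound hconn hsub hcyc hF
  rw [ed_univ] at h
  rw [Nat.card_eq_fintype_card, le_div_iff₀ (by norm_num)]
  have h' : (14 * phi G : ℝ) ≤ 4 * (G.edgeSet.ncard : ℝ) - 2 * (Fintype.card V : ℝ) + 12 := by
    exact_mod_cast h
  linarith
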